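/- arXiv:0904.4774 — 3 statements merged into one kernel-verified Lean document; each statement's English description precedes it below -/
import Mathlib

section
/- Let 1 ≤ p ≤ ∞ with conjugate exponent p' (1/p + 1/p' = 1), let X₀ be a K×N real matrix and D₀ a d×K real matrix with unit Euclidean-norm columns. If μ_p(D₀)·γ(X₀) + β_p(X₀) < α_p(X₀), then there exists c < 1 such that for every k ∈ {1,…,K} and every z ∈ ℝ^{K−1}, |⟨u_k,z⟩| ≤ c·‖X̄_kᵀz‖₁ (conditions (NC) and (SC) hold). In particular, if in addition D₀ is a K×K invertible matrix (an incoherent basis), then (D₀,X₀) is a strict local minimum of problem (P1') with Y := D₀·X₀. -/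
open Matrix Finset
open scoped ENNReal

noncomputable section

/-- Entrywise ℓ1 norm of a matrix: the sum of absolute values of all entries. -/
def l1Norm {m n : Type*} [Fintype m] [Fintype n] (X : Matrix m n ℝ) : ℝ :=
  ∑ i, ∑ j, |X i j|

/-- The dictionary has unit Euclidean-norm columns. -/
def UnitCols {d K : ℕ} (D : Matrix (Fin d) (Fin K) ℝ) : Prop :=
  ∀ k, ∑ i, (D i k) ^ 2 = 1

/-- `(D₀, X₀)` is a strict local minimum of problem (P1'). -/
def IsStrictLocalMinP1 {d K N : ℕ} (Y : Matrix (Fin d) (Fin N) ℝ)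
    (D₀ : Matrix (Fin d) (Fin K) ℝ) (X₀ : Matrix (Fin K) (Fin N) ℝ) : Prop :=
  ∃ U ∈ nhds (D₀, X₀), ∀ DX ∈ U, UnitCols DX.1 → DX.1 * DX.2 = Y →
    l1Norm X₀ ≤ l1Norm DX.2 ∧ (DX.2 ≠ X₀ → l1Norm X₀ < l1Norm DX.2)

/-- The ℓ_p norm of a finitely indexed real vector, `1 ≤ p ≤ ∞`. -/
def lpNorm (p : ℝ≥0∞) [Fact (1 ≤ p)] {ι : Type*} [Fintype ι] (v : ι → ℝ) : ℝ :=
  ‖(WithLp.equiv p (∀ _ : ι, ℝ)).symm v‖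

/-- The vector `u_k = X_k (s^k)ᵀ − diag(‖x^ℓ‖₁)_{ℓ≠k} · m̄_k ∈ ℝ^{K−1}`. -/
def uVec {d K N : ℕ} (D₀ : Matrix (Fin d) (Fin K) ℝ) (X₀ : Matrix (Fin K) (Fin N) ℝ)
    (k : Fin K) (l : {l : Fin K // l ≠ k}) : ℝ :=
  (∑ n ∈ Finset.univ.filter fun n => X₀ k n ≠ 0, X₀ l.1 n * Real.sign (X₀ k n))
    - (∑ n, |X₀ l.1 n|) * (∑ i, D₀ i l.1 * D₀ i k)

/-- `α_p(X₀) := min_k inf_{z≠0} ‖X̄_kᵀ z‖₁ / ‖z‖_{p'}`. -/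
def alphaP (p' : ℝ≥0∞) [Fact (1 ≤ p')] {K N : ℕ} (X₀ : Matrix (Fin K) (Fin N) ℝ) : ℝ :=
  ⨅ (k : Fin K) (z : {z : {l : Fin K // l ≠ k} → ℝ // z ≠ 0}),
    (∑ n ∈ Finset.univ.filter fun n => X₀ k n = 0,
      |∑ l : {l : Fin K // l ≠ k}, X₀ l.1 n * z.1 l|) / lpNorm p' z.1

/-- `β_p(X₀) := max_k ‖X_k (s^k)ᵀ‖_p`. -/
def betaP (p : ℝ≥0∞) [Fact (1 ≤ p)] {K N : ℕ} (X₀ : Matrix (Fin K) (Fin N) ℝ) : ℝ :=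
  ⨆ k : Fin K, lpNorm p (fun l : {l : Fin K // l ≠ k} =>
    ∑ n ∈ Finset.univ.filter fun n => X₀ k n ≠ 0, X₀ l.1 n * Real.sign (X₀ k n))

/-- `γ(X₀) := max_k ‖x^k‖₁`. -/
def gammaX {K N : ℕ} (X₀ : Matrix (Fin K) (Fin N) ℝ) : ℝ :=
  ⨆ k : Fin K, ∑ n, |X₀ k n|

/-- `μ_p(D₀) := max_k ‖m̄_k‖_p`, where `m̄_k = (⟨a_ℓ, a_k⟩)_{ℓ≠k}`. -/
def muP (p : ℝ≥0∞) [Fact (1 ≤ p)] {d K : ℕ} (D₀ : Matrix (Fin d) (Fin K) ℝ) : ℝ :=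
  ⨆ k : Fin K, lpNorm p (fun l : {l : Fin K // l ≠ k} => ∑ i, D₀ i l.1 * D₀ i k)

theorem lpNorm_nonneg (p : ℝ≥0∞) [Fact (1 ≤ p)] {ι : Type*} [Fintype ι] (v : ι → ℝ) :
    0 ≤ lpNorm p v :=
  norm_nonneg _

theorem lpNorm_zero (p : ℝ≥0∞) [Fact (1 ≤ p)] {ι : Type*} [Fintype ι] :
    lpNorm p (0 : ι → ℝ) = 0 :=
  norm_zero

theorem lpNorm_pos (p : ℝ≥0∞) [Fact (1 ≤ p)] {ι : Type*} [Fintype ι] {v : ι → ℝ} (hv : v ≠ 0) :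
    0 < lpNorm p v :=
  norm_pos_iff.mpr fun h => hv (congrArg (WithLp.equiv p (∀ _ : ι, ℝ)) h)

theorem lpNorm_sub_le (p : ℝ≥0∞) [Fact (1 ≤ p)] {ι : Type*} [Fintype ι] (v w : ι → ℝ) :
    lpNorm p (v - w) ≤ lpNorm p v + lpNorm p w :=
  norm_sub_le _ _

theorem continuous_lpNorm (p : ℝ≥0∞) [Fact (1 ≤ p)] {ι : Type*} [Fintype ι] :
    Continuous (lpNorm p : (ι → ℝ) → ℝ) :=
  continuous_norm.comp (PiLp.continuous_toLp p (fun _ : ι => ℝ))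

theorem lpNorm_top {ι : Type*} [Fintype ι] (v : ι → ℝ) : lpNorm ∞ v = ⨆ i, |v i| :=
  PiLp.norm_eq_ciSup _

theorem lpNorm_eq_sum {p : ℝ≥0∞} [Fact (1 ≤ p)] (hp : p ≠ ∞) {ι : Type*} [Fintype ι]
    (v : ι → ℝ) : lpNorm p v = (∑ i, |v i| ^ p.toReal) ^ (1 / p.toReal) :=
  PiLp.norm_eq_sum (ENNReal.toReal_pos (zero_lt_one.trans_le Fact.out).ne' hp) _

theorem lpNorm_one {ι : Type*} [Fintype ι] (v : ι → ℝ) : lpNorm 1 v = ∑ i, |v i| :=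
  PiLp.norm_eq_of_L1 _

theorem abs_apply_le_lpNorm_top {ι : Type*} [Fintype ι] (v : ι → ℝ) (i : ι) :
    |v i| ≤ lpNorm ∞ v := by
  rw [lpNorm_top]
  exact le_ciSup (f := fun i => |v i|) (Set.finite_range _).bddAbove i

theorem lpNorm_mono (p : ℝ≥0∞) [Fact (1 ≤ p)] {ι : Type*} [Fintype ι] {v w : ι → ℝ}
    (h : ∀ i, |v i| ≤ |w i|) : lpNorm p v ≤ lpNorm p w := by
  by_cases hp : p = ∞
  · subst hp
    rw [lpNorm_top, lpNorm_top]
    exact ciSup_mono (Set.finite_range _).bddAbove h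
  · rw [lpNorm_eq_sum hp, lpNorm_eq_sum hp]
    exact Real.rpow_le_rpow (Finset.sum_nonneg fun i _ => by positivity)
      (Finset.sum_le_sum fun i _ =>
        Real.rpow_le_rpow (abs_nonneg _) (h i) ENNReal.toReal_nonneg)
      (one_div_nonneg.mpr ENNReal.toReal_nonneg)

theorem lpNorm_weight_mul_le (p : ℝ≥0∞) [Fact (1 ≤ p)] {ι : Type*} [Fintype ι] {w v : ι → ℝ}
    {c : ℝ} (hw : ∀ i, |w i| ≤ c) (hc : 0 ≤ c) :
    lpNorm p (fun i => w i * v i) ≤ c * lpNorm p v := by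
  have hsmul : lpNorm p (c • v) = c * lpNorm p v :=
    (norm_smul c ((WithLp.equiv p (∀ _ : ι, ℝ)).symm v)).trans
      (by rw [Real.norm_of_nonneg hc]; rfl)
  rw [← hsmul]
  refine lpNorm_mono p fun i => ?_
  rw [Pi.smul_apply, smul_eq_mul, abs_mul, abs_mul, abs_of_nonneg hc]
  exact mul_le_mul_of_nonneg_right (hw i) (abs_nonneg _)

theorem sum_abs_mul_le_top_one {ι : Type*} [Fintype ι] (v w : ι → ℝ) :
    ∑ i, |v i| * |w i| ≤ lpNorm ∞ v * lpNorm 1 w := by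
  rw [lpNorm_one, Finset.mul_sum]
  gcongr with i
  exact abs_apply_le_lpNorm_top v i

/-- Hölder's inequality for finite real vectors, endpoint exponents included. -/
theorem abs_sum_mul_le_lpNorm_mul_lpNorm {p q : ℝ≥0∞} [Fact (1 ≤ p)] [Fact (1 ≤ q)]
    (hpq : 1 / p + 1 / q = 1) {ι : Type*} [Fintype ι] (v w : ι → ℝ) :
    |∑ i, v i * w i| ≤ lpNorm p v * lpNorm q w := by
  have hconj : p.HolderConjugate q := ⟨by simpa using hpq⟩
  have habs : |∑ i, v i * w i| ≤ ∑ i, |v i| * |w i| := by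
    simpa only [abs_mul] using Finset.abs_sum_le_sum_abs (fun i => v i * w i) Finset.univ
  refine habs.trans ?_
  by_cases hp : p = ∞
  · subst hp
    obtain rfl : q = 1 := by simpa using hpq
    exact sum_abs_mul_le_top_one v w
  by_cases hq : q = ∞
  · subst hq
    obtain rfl : p = 1 := by simpa using hpq
    simpa only [mul_comm] using sum_abs_mul_le_top_one w v
  have hreal : p.toReal.HolderConjugate q.toReal :=
    ENNReal.HolderConjugate.toReal_of_ne_top hp hq
  rw [lpNorm_eq_sum hp, lpNorm_eq_sum hq]
  simpa only [abs_abs] using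
    Real.inner_le_Lp_mul_Lq Finset.univ (fun i => |v i|) (fun i => |w i|) hreal

theorem alphaP_mul_lpNorm_le (q : ℝ≥0∞) [Fact (1 ≤ q)] {K N : ℕ}
    (X : Matrix (Fin K) (Fin N) ℝ) (k : Fin K) (z : {l : Fin K // l ≠ k} → ℝ) :
    alphaP q X * lpNorm q z ≤ ∑ n ∈ Finset.univ.filter fun n => X k n = 0,
      |∑ l : {l : Fin K // l ≠ k}, X l.1 n * z l| := by
  by_cases hz : z = 0
  · subst hz
    rw [lpNorm_zero, mul_zero]
    positivity
  rw [← le_div_iff₀ (lpNorm_pos q hz)]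
  have hbdd (k : Fin K) : BddBelow (Set.range
      fun z : {z : {l : Fin K // l ≠ k} → ℝ // z ≠ 0} =>
        (∑ n ∈ Finset.univ.filter fun n => X k n = 0,
          |∑ l : {l : Fin K // l ≠ k}, X l.1 n * z.1 l|) / lpNorm q z.1) :=
    ⟨0, by
      rintro _ ⟨z, rfl⟩
      exact div_nonneg (Finset.sum_nonneg fun _ _ => abs_nonneg _) (lpNorm_nonneg q _)⟩
  exact (ciInf_le (Set.finite_range _).bddBelow k).trans (ciInf_le (hbdd k) ⟨z, hz⟩)

theorem betaP_nonneg (p : ℝ≥0∞) [Fact (1 ≤ p)] {K N : ℕ} (X : Matrix (Fin K) (Fin N) ℝ) :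
    0 ≤ betaP p X :=
  Real.iSup_nonneg fun _ => lpNorm_nonneg p _

theorem gammaX_nonneg {K N : ℕ} (X : Matrix (Fin K) (Fin N) ℝ) : 0 ≤ gammaX X :=
  Real.iSup_nonneg fun _ => Finset.sum_nonneg fun _ _ => abs_nonneg _

theorem muP_nonneg (p : ℝ≥0∞) [Fact (1 ≤ p)] {d K : ℕ} (D : Matrix (Fin d) (Fin K) ℝ) :
    0 ≤ muP p D :=
  Real.iSup_nonneg fun _ => lpNorm_nonneg p _

theorem lpNorm_uVec_le (p : ℝ≥0∞) [Fact (1 ≤ p)] {d K N : ℕ} (D : Matrix (Fin d) (Fin K) ℝ)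
    (X : Matrix (Fin K) (Fin N) ℝ) (k : Fin K) :
    lpNorm p (uVec D X k) ≤ muP p D * gammaX X + betaP p X := by
  have hbeta := le_ciSup (Set.finite_range fun k : Fin K =>
    lpNorm p (fun l : {l : Fin K // l ≠ k} =>
      ∑ n ∈ Finset.univ.filter fun n => X k n ≠ 0, X l.1 n * Real.sign (X k n))).bddAbove k
  have hmu := le_ciSup (Set.finite_range fun k : Fin K =>
    lpNorm p (fun l : {l : Fin K // l ≠ k} => ∑ i, D i l.1 * D i k)).bddAbove k
  have hgamma (l : {l : Fin K // l ≠ k}) : |(∑ n, |X l.1 n| : ℝ)| ≤ gammaX X := by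
    rw [abs_of_nonneg (Finset.sum_nonneg fun _ _ => abs_nonneg _)]
    exact le_ciSup (Set.finite_range fun k : Fin K => ∑ n, |X k n|).bddAbove l.1
  have hweight := lpNorm_weight_mul_le p
    (v := fun l : {l : Fin K // l ≠ k} => ∑ i, D i l.1 * D i k) hgamma (gammaX_nonneg X)
  have hscaled := mul_le_mul_of_nonneg_left hmu (gammaX_nonneg X)
  have htri := lpNorm_sub_le p
    (fun l : {l : Fin K // l ≠ k} =>
      ∑ n ∈ Finset.univ.filter fun n => X k n ≠ 0, X l.1 n * Real.sign (X k n))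
    (fun l => (∑ n, |X l.1 n|) * ∑ i, D i l.1 * D i k)
  calc lpNorm p (uVec D X k) ≤ _ := htri
    _ ≤ betaP p X + gammaX X * muP p D := add_le_add hbeta (hweight.trans hscaled)
    _ = _ := by ring

theorem sum_abs_perturb_ge {ι : Type*} [Fintype ι] (x y : ι → ℝ) (a : ℝ) :
    ∑ n, |x n| + a * ∑ n, |x n| + ∑ n ∈ Finset.univ.filter (fun n => x n = 0), |y n|
      + ∑ n ∈ Finset.univ.filter (fun n => x n ≠ 0), y n * Real.sign (x n)
      ≤ ∑ n, |x n + a * x n + y n| := by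
  rw [Finset.sum_filter, Finset.sum_filter, Finset.mul_sum, ← Finset.sum_add_distrib,
    ← Finset.sum_add_distrib, ← Finset.sum_add_distrib]
  refine Finset.sum_le_sum fun n _ => ?_
  rcases lt_trichotomy (x n) 0 with h | h | h
  · rw [if_neg h.ne, if_pos h.ne, Real.sign_of_neg h, abs_of_neg h]
    linarith [neg_le_abs (x n + a * x n + y n)]
  · simp [h]
  · rw [if_neg h.ne', if_pos h.ne', Real.sign_of_pos h, abs_of_pos h]
    linarith [le_abs_self (x n + a * x n + y n)]

/-- The first-order coefficient vector `X_k (s^k)ᵀ − (‖x^ℓ‖₁ R_{kℓ})_{ℓ≠k}`, which is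
`uVec` when `R` is the Gram matrix of the dictionary. -/
def slopeVec {K N : ℕ} (X : Matrix (Fin K) (Fin N) ℝ) (R : Matrix (Fin K) (Fin K) ℝ)
    (k : Fin K) (l : {l : Fin K // l ≠ k}) : ℝ :=
  (∑ n ∈ Finset.univ.filter fun n => X k n ≠ 0, X l.1 n * Real.sign (X k n))
    - (∑ n, |X l.1 n|) * R k l.1

theorem sum_sum_subtype_ne_comm {K : ℕ} (f : Fin K → Fin K → ℝ) :
    ∑ k, ∑ l : {l : Fin K // l ≠ k}, f k l.1 = ∑ k, ∑ l : {l : Fin K // l ≠ k}, f l.1 k := by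
  have hdiag (g : Fin K → Fin K → ℝ) :
      ∑ k, ∑ l : {l : Fin K // l ≠ k}, g k l.1 = ∑ k, ∑ l, g k l - ∑ k, g k k := by
    rw [← Finset.sum_sub_distrib]
    refine Finset.sum_congr rfl fun k _ => ?_
    rw [Fintype.sum_eq_add_sum_subtype_ne _ k]
    ring
  rw [hdiag, hdiag fun k l => f l k, Finset.sum_comm]

theorem l1Norm_add_mul_ge {K N : ℕ} (X : Matrix (Fin K) (Fin N) ℝ)
    (E R : Matrix (Fin K) (Fin K) ℝ)
    (hdiag : ∀ k, E k k = -∑ l : {l : Fin K // l ≠ k}, E l.1 k * R l.1 k) :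
    l1Norm X + ∑ k, ((∑ n ∈ Finset.univ.filter fun n => X k n = 0,
        |∑ l : {l : Fin K // l ≠ k}, X l.1 n * E k l.1|)
      + ∑ l : {l : Fin K // l ≠ k}, slopeVec X R k l * E k l.1) ≤ l1Norm (X + E * X) := by
  have hswap : ∑ k, E k k * ∑ n, |X k n| =
      -∑ k, ∑ l : {l : Fin K // l ≠ k}, (∑ n, |X l.1 n|) * R k l.1 * E k l.1 := by
    rw [sum_sum_subtype_ne_comm fun k l => (∑ n, |X l n|) * R k l * E k l,
      ← Finset.sum_neg_distrib]
    refine Finset.sum_congr rfl fun k _ => ?_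
    rw [hdiag, neg_mul, Finset.sum_mul]
    exact congrArg Neg.neg (Finset.sum_congr rfl fun l _ => by ring)
  have hrow (k : Fin K) := sum_abs_perturb_ge (X k)
    (fun n => ∑ l : {l : Fin K // l ≠ k}, X l.1 n * E k l.1) (E k k)
  have hentry (k : Fin K) (n : Fin N) : (X + E * X) k n =
      X k n + E k k * X k n + ∑ l : {l : Fin K // l ≠ k}, X l.1 n * E k l.1 := by
    rw [Matrix.add_apply, Matrix.mul_apply, Fintype.sum_eq_add_sum_subtype_ne _ k, add_assoc]
    simp only [mul_comm (E k _)]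
  have hslope (k : Fin K) : ∑ l : {l : Fin K // l ≠ k}, slopeVec X R k l * E k l.1 =
      (∑ n ∈ Finset.univ.filter (fun n => X k n ≠ 0),
        (∑ l : {l : Fin K // l ≠ k}, X l.1 n * E k l.1) * Real.sign (X k n))
      - ∑ l : {l : Fin K // l ≠ k}, (∑ n, |X l.1 n|) * R k l.1 * E k l.1 := by
    simp only [slopeVec, sub_mul, Finset.sum_sub_distrib, Finset.sum_mul]
    rw [Finset.sum_comm]
    simp only [mul_right_comm]
  have htotal := Finset.sum_le_sum fun k (_ : k ∈ Finset.univ) => hrow k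
  simp only [Finset.sum_add_distrib, hslope, Finset.sum_sub_distrib, l1Norm, hentry] at htotal ⊢
  linarith

/-- The inner products `⟨d_l, d_k + a_k⟩` of the columns of two dictionaries. -/
def midGram {d K : ℕ} (D₀ D : Matrix (Fin d) (Fin K) ℝ) (l k : Fin K) : ℝ :=
  ∑ i, D i l * (D i k + D₀ i k)

theorem sum_mul_midGram_eq_zero {d K : ℕ} {D₀ D : Matrix (Fin d) (Fin K) ℝ}
    (h₀ : UnitCols D₀) (h : UnitCols D) {E : Matrix (Fin K) (Fin K) ℝ} (hE : D₀ = D + D * E)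
    (k : Fin K) : ∑ l, E l k * midGram D₀ D l k = 0 := by
  have hcol (i : Fin d) : ∑ l, D i l * E l k = D₀ i k - D i k := by
    have := congrFun (congrFun hE i) k
    rw [Matrix.add_apply, Matrix.mul_apply] at this
    linarith
  calc ∑ l, E l k * midGram D₀ D l k
      = ∑ i, (∑ l, D i l * E l k) * (D i k + D₀ i k) := by
        simp only [midGram, Finset.mul_sum, Finset.sum_mul]
        rw [Finset.sum_comm]
        exact Finset.sum_congr rfl fun i _ => Finset.sum_congr rfl fun l _ => by ring
    _ = ∑ i, D₀ i k ^ 2 - ∑ i, D i k ^ 2 := by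
        rw [← Finset.sum_sub_distrib]
        exact Finset.sum_congr rfl fun i _ => by rw [hcol]; ring
    _ = 0 := by rw [h₀ k, h k, sub_self]

/-- The columnwise normalised `midGram`, which is the Gram matrix of `D₀` at `D = D₀`. -/
def midGramRatio {d K : ℕ} (D₀ D : Matrix (Fin d) (Fin K) ℝ) : Matrix (Fin K) (Fin K) ℝ :=
  Matrix.of fun l k => midGram D₀ D l k / midGram D₀ D k k

theorem midGram_self {d K : ℕ} (D : Matrix (Fin d) (Fin K) ℝ) (l k : Fin K) :
    midGram D D l k = 2 * ∑ i, D i l * D i k := by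
  rw [midGram, Finset.mul_sum]
  exact Finset.sum_congr rfl fun i _ => by ring

theorem midGram_self_diag {d K : ℕ} {D : Matrix (Fin d) (Fin K) ℝ} (h : UnitCols D)
    (k : Fin K) : midGram D D k k = 2 := by
  rw [midGram_self]
  simp only [← pow_two]
  rw [h k, mul_one]

theorem continuous_midGram {d K : ℕ} (D₀ : Matrix (Fin d) (Fin K) ℝ) (l k : Fin K) :
    Continuous fun D => midGram D₀ D l k := by
  unfold midGram
  fun_prop

theorem slopeVec_midGramRatio_self {d K N : ℕ} {D : Matrix (Fin d) (Fin K) ℝ}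
    (h : UnitCols D) (X : Matrix (Fin K) (Fin N) ℝ) (k : Fin K) :
    slopeVec X (midGramRatio D D) k = uVec D X k := by
  funext l
  rw [slopeVec, uVec, midGramRatio, Matrix.of_apply, midGram_self_diag h, midGram_self,
    mul_div_cancel_left₀ _ two_ne_zero]
  simp only [mul_comm (D _ k)]

theorem continuousAt_lpNorm_slopeVec (p : ℝ≥0∞) [Fact (1 ≤ p)] {d K N : ℕ}
    {D₀ : Matrix (Fin d) (Fin K) ℝ} (h₀ : UnitCols D₀) (X : Matrix (Fin K) (Fin N) ℝ)
    (k : Fin K) :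
    ContinuousAt (fun D => lpNorm p (slopeVec X (midGramRatio D₀ D) k)) D₀ := by
  refine (continuous_lpNorm p).continuousAt.comp (continuousAt_pi.mpr fun l => ?_)
  refine continuousAt_const.sub (continuousAt_const.mul ?_)
  refine (continuous_midGram D₀ k l.1).continuousAt.div
    (continuous_midGram D₀ l.1 l.1).continuousAt ?_
  rw [midGram_self_diag h₀]
  exact two_ne_zero

theorem l1Norm_le_and_lt_of_lpNorm_slopeVec_lt {p p' : ℝ≥0∞} [Fact (1 ≤ p)] [Fact (1 ≤ p')]
    (hconj : 1 / p + 1 / p' = 1) {d K N : ℕ} {D₀ D : Matrix (Fin d) (Fin K) ℝ}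
    (h₀ : UnitCols D₀) (h : UnitCols D) (X : Matrix (Fin K) (Fin N) ℝ)
    (hmid : ∀ k, midGram D₀ D k k ≠ 0)
    (hslope : ∀ k, lpNorm p (slopeVec X (midGramRatio D₀ D) k) < alphaP p' X)
    {E : Matrix (Fin K) (Fin K) ℝ} (hE : D₀ = D + D * E) :
    l1Norm X ≤ l1Norm (X + E * X) ∧ (X + E * X ≠ X → l1Norm X < l1Norm (X + E * X)) := by
  have hdiag (k : Fin K) :
      E k k = -∑ l : {l : Fin K // l ≠ k}, E l.1 k * midGramRatio D₀ D l.1 k := by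
    have hsum := sum_mul_midGram_eq_zero h₀ h hE k
    rw [Fintype.sum_eq_add_sum_subtype_ne _ k] at hsum
    simp only [midGramRatio, Matrix.of_apply, ← mul_div_assoc]
    rw [← Finset.sum_div, ← neg_div, eq_div_iff (hmid k)]
    linarith
  have hge := l1Norm_add_mul_ge X E (midGramRatio D₀ D) hdiag
  have hterm (k : Fin K) :
      (alphaP p' X - lpNorm p (slopeVec X (midGramRatio D₀ D) k)) *
          lpNorm p' (fun l : {l : Fin K // l ≠ k} => E k l.1) ≤
        (∑ n ∈ Finset.univ.filter fun n => X k n = 0,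
          |∑ l : {l : Fin K // l ≠ k}, X l.1 n * E k l.1|)
        + ∑ l : {l : Fin K // l ≠ k}, slopeVec X (midGramRatio D₀ D) k l * E k l.1 := by
    have halpha := alphaP_mul_lpNorm_le p' X k fun l => E k l.1
    have hholder := neg_le_of_abs_le (abs_sum_mul_le_lpNorm_mul_lpNorm hconj
      (slopeVec X (midGramRatio D₀ D) k) fun l => E k l.1)
    linarith
  have hterm_nonneg (k : Fin K) := (mul_nonneg (sub_pos.mpr (hslope k)).le
    (lpNorm_nonneg p' fun l : {l : Fin K // l ≠ k} => E k l.1)).trans (hterm k)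
  refine ⟨by linarith [Finset.sum_nonneg fun k (_ : k ∈ Finset.univ) => hterm_nonneg k],
    fun hne => ?_⟩
  obtain ⟨k, hk⟩ : ∃ k, (fun l : {l : Fin K // l ≠ k} => E k l.1) ≠ 0 := by
    by_contra! hoff
    have hoff' (k l : Fin K) (hl : l ≠ k) : E k l = 0 := congrFun (hoff k) ⟨l, hl⟩
    have hzero : E = 0 := by
      ext k l
      by_cases hl : l = k
      · subst hl
        rw [hdiag, Finset.sum_eq_zero fun j _ => by rw [hoff' j.1 l j.2.symm, zero_mul], neg_zero,
          Matrix.zero_apply]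
      · exact hoff' k l hl
    exact hne (by rw [hzero, Matrix.zero_mul, add_zero])
  have hpos := Finset.sum_pos' (fun k _ => hterm_nonneg k) ⟨k, Finset.mem_univ k,
    (mul_pos (sub_pos.mpr (hslope k)) (lpNorm_pos p' hk)).trans_le (hterm k)⟩
  linarith

theorem isStrictLocalMinP1_of_lpNorm_uVec_lt {p p' : ℝ≥0∞} [Fact (1 ≤ p)] [Fact (1 ≤ p')]
    (hconj : 1 / p + 1 / p' = 1) {K N : ℕ} {D₀ : Matrix (Fin K) (Fin K) ℝ}
    (h₀ : UnitCols D₀) (hinv : IsUnit D₀) (X : Matrix (Fin K) (Fin N) ℝ)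
    (hu : ∀ k, lpNorm p (uVec D₀ X k) < alphaP p' X) :
    IsStrictLocalMinP1 (D₀ * X) D₀ X := by
  have hdet : D₀.det ≠ 0 := ((Matrix.isUnit_iff_isUnit_det D₀).mp hinv).ne_zero
  have hdet_near : ∀ᶠ D in nhds D₀, D.det ≠ 0 :=
    (continuous_id.matrix_det).continuousAt.eventually_ne hdet
  have hmid_near : ∀ᶠ D in nhds D₀, ∀ k, midGram D₀ D k k ≠ 0 :=
    Filter.eventually_all.mpr fun k =>
      (continuous_midGram D₀ k k).continuousAt.eventually_ne
        (by rw [midGram_self_diag h₀]; exact two_ne_zero)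
  have hslope_near : ∀ᶠ D in nhds D₀, ∀ k,
      lpNorm p (slopeVec X (midGramRatio D₀ D) k) < alphaP p' X :=
    Filter.eventually_all.mpr fun k =>
      (continuousAt_lpNorm_slopeVec p h₀ X k).eventually_lt_const
        (by simpa only [slopeVec_midGramRatio_self h₀] using hu k)
  refine ⟨_, continuous_fst.continuousAt.eventually
    (hdet_near.and (hmid_near.and hslope_near)), ?_⟩
  rintro ⟨D, Z⟩ ⟨hD, hmid, hslope⟩ hunit hDZ
  dsimp only at hD hmid hslope hunit hDZ ⊢
  have hDunit : IsUnit D.det := hD.isUnit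
  have hE : D₀ = D + D * (D⁻¹ * D₀ - 1) := by
    rw [Matrix.mul_sub, Matrix.mul_nonsing_inv_cancel_left D D₀ hDunit, Matrix.mul_one]
    abel
  have hZ : Z = X + (D⁻¹ * D₀ - 1) * X := by
    rw [Matrix.sub_mul, Matrix.one_mul, Matrix.mul_assoc, ← hDZ,
      Matrix.nonsing_inv_mul_cancel_left D Z hDunit]
    abel
  rw [hZ]
  exact l1Norm_le_and_lt_of_lpNorm_slopeVec_lt hconj h₀ hunit X hmid hslope hE

/-- **Theorem (incoherence implies (NC)/(SC), and local identifiability for bases).**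
If `μ_p(D₀)·γ(X₀) + β_p(X₀) < α_p(X₀)` then conditions (NC) and (SC) hold, i.e. there is
`c < 1` with `|⟨u_k, z⟩| ≤ c·‖X̄_kᵀ z‖₁` for all `k, z`; and if moreover `D₀` is a
(square, invertible) basis — i.e. `D₀ : ℝ^K → ℝ^d` is bijective — then `(D₀,X₀)` is a
strict local minimum of (P1') with `Y := D₀·X₀`. -/
theorem stmt2 {d K N : ℕ} (p p' : ℝ≥0∞) [Fact (1 ≤ p)] [Fact (1 ≤ p')]
    (hconj : 1 / p + 1 / p' = 1)
    (D₀ : Matrix (Fin d) (Fin K) ℝ) (X₀ : Matrix (Fin K) (Fin N) ℝ)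
    (hunit : UnitCols D₀)
    (hincoh : muP p D₀ * gammaX X₀ + betaP p X₀ < alphaP p' X₀) :
    (∃ c : ℝ, c < 1 ∧ ∀ (k : Fin K) (z : {l : Fin K // l ≠ k} → ℝ),
      |∑ l, uVec D₀ X₀ k l * z l| ≤
        c * ∑ n ∈ Finset.univ.filter fun n => X₀ k n = 0,
          |∑ l : {l : Fin K // l ≠ k}, X₀ l.1 n * z l|) ∧
    (Function.Bijective D₀.mulVec → IsStrictLocalMinP1 (D₀ * X₀) D₀ X₀) := by
  have hnonneg : 0 ≤ muP p D₀ * gammaX X₀ + betaP p X₀ :=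
    add_nonneg (mul_nonneg (muP_nonneg p D₀) (gammaX_nonneg X₀)) (betaP_nonneg p X₀)
  have hslope (k : Fin K) := (lpNorm_uVec_le p D₀ X₀ k).trans_lt hincoh
  refine ⟨⟨(muP p D₀ * gammaX X₀ + betaP p X₀) / alphaP p' X₀, ?_, fun k z => ?_⟩, fun hbij => ?_⟩
  · exact (div_lt_one (hnonneg.trans_lt hincoh)).mpr hincoh
  · calc |∑ l, uVec D₀ X₀ k l * z l|
        ≤ lpNorm p (uVec D₀ X₀ k) * lpNorm p' z := abs_sum_mul_le_lpNorm_mul_lpNorm hconj _ _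
      _ ≤ (muP p D₀ * gammaX X₀ + betaP p X₀) * lpNorm p' z :=
          mul_le_mul_of_nonneg_right (lpNorm_uVec_le p D₀ X₀ k) (lpNorm_nonneg p' z)
      _ = (muP p D₀ * gammaX X₀ + betaP p X₀) / alphaP p' X₀ * (alphaP p' X₀ * lpNorm p' z) := by
          rw [← mul_assoc, div_mul_cancel₀ _ (hnonneg.trans_lt hincoh).ne']
      _ ≤ _ := mul_le_mul_of_nonneg_left (alphaP_mul_lpNorm_le p' X₀ k z)
          (div_nonneg hnonneg (hnonneg.trans_lt hincoh).le)
  · obtain rfl : K = d := by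
      simpa using (LinearEquiv.ofBijective D₀.mulVecLin hbij).finrank_eq
    exact isStrictLocalMinP1_of_lpNorm_uVec_lt hconj hunit
      (Matrix.mulVec_injective_iff_isUnit.mp hbij.injective) X₀ hslope
end
end

section
/- Let 0 < p < 4/5, let K, N be positive integers with N > πK/(2(1−p)²), and let D₀ be a K×K invertible real matrix with unit Euclidean-norm columns such that μ₂(D₀) < 1 − p − √(πK/(2N)). Let X be a random K×N matrix whose law is the product measure with i.i.d. Bernoulli–Gaussian entries of parameter p. Then for every ε ∈ (0, 1/5) satisfying μ₂(D₀) ≤ (1−p)(1−5ε) − √((π/2)·(K/N + ε)·(1 + ε/p)), the (outer) probability of the event that (D₀, X) is NOT a strict local minimum of problem (P1') with Y := D₀·X is at most 4K·exp( (K/2)·log(9K/(ε²p)) − N·p·(1−p)·ε²·(1−2ε)/2 ). -/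
open Matrix Finset MeasureTheory
open scoped ENNReal

noncomputable section

/-- The Bernoulli–Gaussian measure `ν_p = (1−p)·δ₀ + p·N(0,1)` on `ℝ`. -/
def bernoulliGaussian (p : ℝ) : Measure ℝ :=
  (1 - p).toNNReal • Measure.dirac (0 : ℝ)
    + p.toNNReal • ProbabilityTheory.gaussianReal 0 1

instance (p : ℝ) : IsFiniteMeasure (bernoulliGaussian p) := by
  unfold bernoulliGaussian; infer_instance

/-- `μ₂(D₀) := max_k (Σ_{ℓ≠k} ⟨a_ℓ, a_k⟩²)^{1/2}`. -/
def mu2 {d K : ℕ} (D₀ : Matrix (Fin d) (Fin K) ℝ) : ℝ :=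
  ⨆ k : Fin K, Real.sqrt (∑ l ∈ Finset.univ.erase k, (∑ i, D₀ i l * D₀ i k) ^ 2)

/-- The right-hand derivative of `t ↦ |z + t * v|` at `0`. -/
def absDeriv (z v : ℝ) : ℝ := if z = 0 then |v| else Real.sign z * v

lemma abs_add_absDeriv_le (z v : ℝ) : |z| + absDeriv z v ≤ |z + v| := by
  unfold absDeriv
  rcases lt_trichotomy z 0 with h | h | h
  · rw [if_neg h.ne, Real.sign_of_neg h, abs_of_neg h]
    have := neg_abs_le (z + v)
    linarith
  · simp [h]
  · rw [if_neg h.ne', Real.sign_of_pos h, abs_of_pos h]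
    have := le_abs_self (z + v)
    linarith

lemma absDeriv_add_mul_self (z v t : ℝ) : absDeriv z (t * z + v) = t * |z| + absDeriv z v := by
  unfold absDeriv
  rcases lt_trichotomy z 0 with h | h | h
  · rw [if_neg h.ne, if_neg h.ne, Real.sign_of_neg h, abs_of_neg h]; ring
  · simp [h]
  · rw [if_neg h.ne', if_neg h.ne', Real.sign_of_pos h, abs_of_pos h]; ring

lemma abs_absDeriv_sub_le (z v w : ℝ) : |absDeriv z v - absDeriv z w| ≤ |v - w| := by
  unfold absDeriv
  rcases lt_trichotomy z 0 with h | h | h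
  · rw [if_neg h.ne, if_neg h.ne, Real.sign_of_neg h, ← abs_neg]
    exact le_of_eq (congrArg _ (by ring))
  · simpa [h] using abs_abs_sub_abs_le v w
  · rw [if_neg h.ne', if_neg h.ne', Real.sign_of_pos h]; simp

lemma absDeriv_mul (z v : ℝ) {t : ℝ} (ht : 0 ≤ t) : absDeriv z (t * v) = t * absDeriv z v := by
  unfold absDeriv
  split_ifs
  · rw [abs_mul, abs_of_nonneg ht]
  · ring

lemma l1Norm_nonneg {m n : Type*} [Fintype m] [Fintype n] (X : Matrix m n ℝ) : 0 ≤ l1Norm X :=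
  sum_nonneg fun _ _ => sum_nonneg fun _ _ => abs_nonneg _

lemma abs_le_l1Norm {m n : Type*} [Fintype m] [Fintype n] (X : Matrix m n ℝ) (i : m) (j : n) :
    |X i j| ≤ l1Norm X :=
  (single_le_sum (f := fun j => |X i j|) (fun _ _ => abs_nonneg _) (mem_univ j)).trans
    (single_le_sum (f := fun i => ∑ j, |X i j|)
      (fun _ _ => sum_nonneg fun _ _ => abs_nonneg _) (mem_univ i))

lemma sum_abs_row_le_l1Norm {m n : Type*} [Fintype m] [Fintype n] (X : Matrix m n ℝ) (i : m) :
    ∑ j, |X i j| ≤ l1Norm X :=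
  single_le_sum (f := fun i => ∑ j, |X i j|)
    (fun _ _ => sum_nonneg fun _ _ => abs_nonneg _) (mem_univ i)

lemma sum_abs_col_le_l1Norm {m n : Type*} [Fintype m] [Fintype n] (X : Matrix m n ℝ) (j : n) :
    ∑ i, |X i j| ≤ l1Norm X :=
  sum_le_sum fun i _ =>
    single_le_sum (f := fun j => |X i j|) (fun _ _ => abs_nonneg _) (mem_univ j)

lemma continuous_l1Norm {m n : Type*} [Fintype m] [Fintype n] :
    Continuous (l1Norm : Matrix m n ℝ → ℝ) := by
  unfold l1Norm; fun_prop

/-- The Gram matrix of a matrix with unit columns has entries in `[-1, 1]`. -/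
lemma UnitCols.abs_gram_le_one {d K : ℕ} {D : Matrix (Fin d) (Fin K) ℝ} (hD : UnitCols D)
    (k l : Fin K) : |∑ i, D i k * D i l| ≤ 1 := by
  rw [abs_le_one_iff_mul_self_le_one, ← sq]
  simpa [hD k, hD l] using sum_mul_sq_le_sq_mul_sq univ (fun i => D i k) (fun i => D i l)

/-- Euclidean norm of a combination of unit vectors. -/
lemma UnitCols.sum_sq_mulVec_le {d K : ℕ} {D : Matrix (Fin d) (Fin K) ℝ} (hD : UnitCols D)
    (c : Fin K → ℝ) : ∑ i, (∑ l, D i l * c l) ^ 2 ≤ (∑ l, |c l|) ^ 2 := by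
  have h : ∑ i, (∑ l, D i l * c l) ^ 2 = ∑ k, ∑ l, c k * c l * ∑ i, D i k * D i l := by
    simp_rw [sq, sum_mul_sum, mul_sum]
    rw [sum_comm]
    refine sum_congr rfl fun k _ => ?_
    rw [sum_comm]
    exact sum_congr rfl fun l _ => sum_congr rfl fun i _ => by ring
  rw [h, sq, sum_mul_sum]
  refine sum_le_sum fun k _ => sum_le_sum fun l _ => ?_
  calc c k * c l * ∑ i, D i k * D i l ≤ |c k * c l * ∑ i, D i k * D i l| := le_abs_self _
    _ = |c k| * |c l| * |∑ i, D i k * D i l| := by rw [abs_mul, abs_mul]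
    _ ≤ |c k| * |c l| * 1 := by gcongr; exact hD.abs_gram_le_one k l
    _ = _ := mul_one _

/-- If `D * (1 + C) = D₀` and both dictionaries have unit columns, the diagonal of `C` is
determined by the off-diagonal part up to a quadratic error. -/
lemma abs_gram_mul_diag_le {d K : ℕ} {D D₀ : Matrix (Fin d) (Fin K) ℝ} (hD : UnitCols D)
    (hD₀ : UnitCols D₀) {C : Matrix (Fin K) (Fin K) ℝ} (h : D * (1 + C) = D₀) (k : Fin K) :
    |∑ l, (∑ i, D₀ i l * D₀ i k) * C l k| ≤ 3 / 2 * l1Norm C * ∑ l, |C l k| := by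
  set S := l1Norm C
  set e : Matrix (Fin d) (Fin K) ℝ := D * C with he
  have hde : ∀ i l, D₀ i l = D i l + e i l := fun i l => by
    rw [← h, Matrix.mul_add, Matrix.mul_one, Matrix.add_apply]
  have hS : 0 ≤ S := l1Norm_nonneg C
  have hcol : ∀ l, 0 ≤ ∑ j, |C j l| := fun l => sum_nonneg fun _ _ => abs_nonneg _
  have hcolS : ∀ l, ∑ j, |C j l| ≤ S := sum_abs_col_le_l1Norm C
  have hen : ∀ l, ∑ i, (e i l) ^ 2 ≤ (∑ j, |C j l|) ^ 2 := fun l =>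
    hD.sum_sq_mulVec_le fun j => C j l
  have hself : 2 * ∑ i, D₀ i k * e i k = ∑ i, (e i k) ^ 2 := by
    have h1 := hD k
    have h2 := hD₀ k
    have : ∑ i, (D i k) ^ 2 = ∑ i, (D₀ i k) ^ 2 - 2 * ∑ i, D₀ i k * e i k + ∑ i, (e i k) ^ 2 := by
      rw [mul_sum, ← sum_sub_distrib, ← sum_add_distrib]
      exact sum_congr rfl fun i _ => by rw [hde i k]; ring
    linarith
  have hcross : ∀ l, |∑ i, e i l * D₀ i k| ≤ S := fun l => by
    have h1 := sum_mul_sq_le_sq_mul_sq univ (fun i => e i l) (fun i => D₀ i k)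
    rw [hD₀ k, mul_one] at h1
    exact (abs_le_of_sq_le_sq (h1.trans (hen l)) (hcol l)).trans (hcolS l)
  have hmain : ∑ l, (∑ i, D₀ i l * D₀ i k) * C l k
      = ∑ i, D₀ i k * e i k + ∑ l, (∑ i, e i l * D₀ i k) * C l k := by
    have : ∑ i, D₀ i k * e i k = ∑ l, (∑ i, D i l * D₀ i k) * C l k := by
      simp_rw [he, Matrix.mul_apply, mul_sum, sum_mul]
      rw [sum_comm]
      exact sum_congr rfl fun l _ => sum_congr rfl fun i _ => by ring
    rw [this, ← sum_add_distrib]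
    refine sum_congr rfl fun l _ => ?_
    rw [← add_mul, ← sum_add_distrib]
    congr 1
    exact sum_congr rfl fun i _ => by rw [hde i l]; ring
  have hA : |∑ i, D₀ i k * e i k| ≤ 1 / 2 * S * ∑ l, |C l k| := by
    have h0 : 0 ≤ ∑ i, (e i k) ^ 2 := sum_nonneg fun _ _ => sq_nonneg _
    rw [abs_of_nonneg (by linarith)]
    have := hen k
    have := mul_le_mul_of_nonneg_right (hcolS k) (hcol k)
    nlinarith
  have hB : |∑ l, (∑ i, e i l * D₀ i k) * C l k| ≤ S * ∑ l, |C l k| := by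
    rw [mul_sum]
    refine (abs_sum_le_sum_abs _ _).trans (sum_le_sum fun l _ => ?_)
    rw [abs_mul]
    exact mul_le_mul_of_nonneg_right (hcross l) (abs_nonneg _)
  rw [hmain]
  refine (abs_add_le _ _).trans ?_
  linarith

/-- Convexity lower bound for the `ℓ¹` norm of a perturbation `(1 + C) * X`. -/
lemma l1Norm_add_le {K N : ℕ} (X : Matrix (Fin K) (Fin N) ℝ) (C : Matrix (Fin K) (Fin K) ℝ) :
    l1Norm X + ∑ k, (C k k * ∑ n, |X k n|
      + ∑ n, absDeriv (X k n) (∑ l ∈ univ.erase k, C k l * X l n)) ≤ l1Norm ((1 + C) * X) := by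
  unfold l1Norm
  rw [← sum_add_distrib]
  refine sum_le_sum fun k _ => ?_
  rw [mul_sum, ← sum_add_distrib, ← sum_add_distrib]
  refine sum_le_sum fun n _ => ?_
  rw [← absDeriv_add_mul_self]
  have : ((1 + C) * X : Matrix (Fin K) (Fin N) ℝ) k n
      = X k n + (C k k * X k n + ∑ l ∈ univ.erase k, C k l * X l n) := by
    rw [Matrix.add_mul, Matrix.one_mul, Matrix.add_apply, Matrix.mul_apply,
      ← add_sum_erase _ _ (mem_univ k)]
  rw [this]
  exact abs_add_absDeriv_le _ _

/-- A quantitative first-order condition for strict local minimality. -/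
lemma isStrictLocalMinP1_of_gap {K N : ℕ} {D₀ : Matrix (Fin K) (Fin K) ℝ} (hunit : UnitCols D₀)
    (hbasis : IsUnit D₀) (X : Matrix (Fin K) (Fin N) ℝ) {η : ℝ} (hη : 0 < η)
    (hgap : ∀ k, ∀ c : Fin K → ℝ, c k = 0 →
      η * ∑ l, |c l| + ∑ l, c l * ((∑ i, D₀ i l * D₀ i k) * ∑ n, |X l n|)
        ≤ ∑ n, absDeriv (X k n) (∑ l, c l * X l n)) :
    IsStrictLocalMinP1 (D₀ * X) D₀ X := by
  have hdet : IsUnit D₀.det := (Matrix.isUnit_iff_isUnit_det _).1 hbasis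
  have hcont : ContinuousAt (fun DX : Matrix (Fin K) (Fin K) ℝ × Matrix (Fin K) (Fin N) ℝ =>
      l1Norm (DX.1⁻¹ * D₀ - 1)) (D₀, X) := by
    have h1 : ContinuousAt Inv.inv D₀ := by
      refine continuousAt_matrix_inv D₀ ?_
      rw [Ring.inverse_eq_inv']
      exact continuousAt_inv₀ hdet.ne_zero
    have h2 : ContinuousAt (fun DX : Matrix (Fin K) (Fin K) ℝ × Matrix (Fin K) (Fin N) ℝ =>
        DX.1⁻¹) (D₀, X) := ContinuousAt.comp (g := Inv.inv) h1 continuousAt_fst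
    exact continuous_l1Norm.continuousAt.comp ((h2.mul continuousAt_const).sub continuousAt_const)
  have hdetcont : ContinuousAt (fun DX : Matrix (Fin K) (Fin K) ℝ × Matrix (Fin K) (Fin N) ℝ =>
      DX.1.det) (D₀, X) := (continuous_fst.matrix_det).continuousAt
  set L := l1Norm X with hL
  have hL0 : 0 ≤ L := l1Norm_nonneg X
  set s := min (1 / 6) (η / (5 * (L + 1))) with hs
  have hs0 : 0 < s := by positivity
  have hzero : l1Norm (D₀⁻¹ * D₀ - 1) = 0 := by
    rw [Matrix.nonsing_inv_mul _ hdet, sub_self]; simp [l1Norm]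
  refine ⟨{DX | l1Norm (DX.1⁻¹ * D₀ - 1) < s ∧ DX.1.det ≠ 0},
    (hcont.eventually_lt continuousAt_const (by simpa [hzero] using hs0)).and
      (hdetcont.eventually_ne hdet.ne_zero), ?_⟩
  rintro ⟨D, X'⟩ ⟨hS, hD0⟩ hD hDX
  simp only at hS hD0 hD hDX ⊢
  have hDu : IsUnit D.det := isUnit_iff_ne_zero.2 hD0
  obtain ⟨C, hC⟩ : ∃ C, C = D⁻¹ * D₀ - 1 := ⟨_, rfl⟩
  rw [← hC] at hS
  have hC1 : 1 + C = D⁻¹ * D₀ := by rw [hC]; abel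
  have hDC : D * (1 + C) = D₀ := by
    rw [hC1, ← Matrix.mul_assoc, Matrix.mul_nonsing_inv _ hDu, Matrix.one_mul]
  have hX' : X' = (1 + C) * X := by
    rw [hC1, Matrix.mul_assoc, ← hDX, ← Matrix.mul_assoc, Matrix.nonsing_inv_mul _ hDu,
      Matrix.one_mul]
  set S := l1Norm C with hSdef
  have hS0 : 0 ≤ S := l1Norm_nonneg C
  have hdiag := abs_gram_mul_diag_le hD hunit hDC
  set r : Fin K → ℝ := fun k => ∑ l, (∑ i, D₀ i l * D₀ i k) * C l k with hr
  set O := ∑ k, ∑ l ∈ univ.erase k, |C k l| with hO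
  have hOswap : ∑ k, ∑ l ∈ univ.erase k, |C l k| = O := by
    rw [hO]
    refine sum_comm' fun k l => ?_
    simp [ne_comm]
  have hSO : S = ∑ k, |C k k| + O := by
    rw [hSdef, hO, l1Norm, ← sum_add_distrib]
    exact sum_congr rfl fun k _ => (add_sum_erase _ _ (mem_univ k)).symm
  have hcolsum : ∑ k, ∑ l, |C l k| = S := by rw [hSdef, l1Norm, sum_comm]
  have hrsum : ∑ k, |r k| ≤ 3 / 2 * S * S := by
    calc ∑ k, |r k| ≤ ∑ k, 3 / 2 * S * ∑ l, |C l k| := sum_le_sum fun k _ => hdiag k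
      _ = 3 / 2 * S * S := by rw [← mul_sum, hcolsum]
  have hCkk : ∀ k, C k k = r k - ∑ l ∈ univ.erase k, (∑ i, D₀ i l * D₀ i k) * C l k := fun k => by
    have h1 : ∑ i, D₀ i k * D₀ i k = 1 := by simpa [sq] using hunit k
    have : r k = C k k + ∑ l ∈ univ.erase k, (∑ i, D₀ i l * D₀ i k) * C l k := by
      simp only [hr]
      rw [← add_sum_erase _ _ (mem_univ k), h1, one_mul]
    linarith
  have hdiagO : ∑ k, |C k k| ≤ 3 / 2 * S * S + O := by
    rw [← hOswap]
    calc ∑ k, |C k k| ≤ ∑ k, (|r k| + ∑ l ∈ univ.erase k, |C l k|) := by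
          refine sum_le_sum fun k _ => ?_
          rw [hCkk k]
          refine (abs_sub _ _).trans (add_le_add le_rfl ?_)
          refine (abs_sum_le_sum_abs _ _).trans (sum_le_sum fun l _ => ?_)
          rw [abs_mul]
          exact mul_le_of_le_one_left (abs_nonneg _) (hunit.abs_gram_le_one l k)
      _ ≤ _ := by rw [sum_add_distrib]; linarith
  have hS6 : S ≤ 1 / 6 := hS.le.trans (min_le_left _ _)
  have hS3 : S ≤ 3 * O := by nlinarith
  have hrow : ∀ k, η * ∑ l ∈ univ.erase k, |C k l|
      + ∑ l ∈ univ.erase k, C k l * ((∑ i, D₀ i l * D₀ i k) * ∑ n, |X l n|)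
      ≤ ∑ n, absDeriv (X k n) (∑ l ∈ univ.erase k, C k l * X l n) := fun k => by
    have key : ∀ f : Fin K → ℝ, ∑ l, (if l = k then 0 else C k l) * f l
        = ∑ l ∈ univ.erase k, C k l * f l := fun f => by
      rw [← add_sum_erase _ _ (mem_univ k), if_pos rfl, zero_mul, zero_add]
      exact sum_congr rfl fun l hl => by rw [if_neg (ne_of_mem_erase hl)]
    have keyabs : ∑ l, |if l = k then 0 else C k l| = ∑ l ∈ univ.erase k, |C k l| := by
      rw [← add_sum_erase _ _ (mem_univ k), if_pos rfl, abs_zero, zero_add]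
      exact sum_congr rfl fun l hl => by rw [if_neg (ne_of_mem_erase hl)]
    have := hgap k (fun l => if l = k then 0 else C k l) (if_pos rfl)
    simpa only [key, keyabs] using this
  have hswap : ∑ k, (∑ l ∈ univ.erase k, (∑ i, D₀ i l * D₀ i k) * C l k) * ∑ n, |X k n|
      = ∑ k, ∑ l ∈ univ.erase k, C k l * ((∑ i, D₀ i l * D₀ i k) * ∑ n, |X l n|) := by
    rw [sum_congr rfl fun k _ => sum_mul (univ.erase k) _ _,
      sum_comm' (t' := univ) (s' := fun l => univ.erase l) (by simp [ne_comm])]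
    refine sum_congr rfl fun k _ => sum_congr rfl fun l _ => ?_
    have : ∑ i, D₀ i k * D₀ i l = ∑ i, D₀ i l * D₀ i k := sum_congr rfl fun i _ => mul_comm _ _
    rw [this]; ring
  have hrX : - (3 / 2 * S * S * L) ≤ ∑ k, r k * ∑ n, |X k n| := by
    have : |∑ k, r k * (∑ n, |X k n|)| ≤ 3 / 2 * S * S * L := by
      calc |∑ k, r k * (∑ n, |X k n|)| ≤ ∑ k, |r k| * L := by
            refine (abs_sum_le_sum_abs _ _).trans (sum_le_sum fun k _ => ?_)
            rw [abs_mul, abs_of_nonneg (sum_nonneg fun _ _ => abs_nonneg _ : 0 ≤ ∑ n, |X k n|)]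
            exact mul_le_mul_of_nonneg_left (sum_abs_row_le_l1Norm X k) (abs_nonneg _)
        _ ≤ _ := by rw [← sum_mul]; exact mul_le_mul_of_nonneg_right hrsum hL0
    linarith [neg_abs_le (∑ k, r k * (∑ n, |X k n|))]
  have hlow : L + (η * O - 3 / 2 * S * S * L) ≤ l1Norm X' := by
    rw [hX']
    refine le_trans ?_ (l1Norm_add_le X C)
    have h1 := sum_le_sum fun k (_ : k ∈ univ) => hrow k
    rw [sum_add_distrib, ← mul_sum, ← hswap] at h1
    have h2 : ∑ k, C k k * ∑ n, |X k n| = ∑ k, r k * ∑ n, |X k n|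
        - ∑ k, (∑ l ∈ univ.erase k, (∑ i, D₀ i l * D₀ i k) * C l k) * ∑ n, |X k n| := by
      rw [← sum_sub_distrib]
      exact sum_congr rfl fun k _ => by rw [← sub_mul, ← hCkk k]
    rw [sum_add_distrib, h2]
    linarith
  have hpos : 0 < S → 0 < η * O - 3 / 2 * S * S * L := fun hSpos => by
    have h1 : S * (5 * (L + 1)) < η := by
      rw [← lt_div_iff₀ (by positivity)]
      exact hS.trans_le (min_le_right _ _)
    have h2 : η * S ≤ 3 * (η * O) := by nlinarith
    nlinarith [mul_lt_mul_of_pos_left h1 hSpos, mul_nonneg (mul_self_nonneg S) hL0]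
  rcases hS0.eq_or_lt with h0 | h0
  · have hC0 : C = 0 := by
      ext i j
      have := abs_le_l1Norm C i j
      rw [← hSdef, ← h0] at this
      simpa using this
    have : X' = X := by rw [hX', hC0, add_zero, Matrix.one_mul]
    exact ⟨by rw [this], fun h => absurd this h⟩
  · have := hpos h0
    exact ⟨by linarith, fun _ => by linarith⟩

section Gaussian

open ProbabilityTheory

lemma integral_abs_gaussianReal : ∫ x, |x| ∂(gaussianReal 0 1) = √(2 / Real.pi) := by
  rw [integral_gaussianReal_eq_integral_smul one_ne_zero]
  have h1 : ∀ x : ℝ, gaussianPDFReal 0 1 x • |x|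
      = (√(2 * Real.pi))⁻¹ * (fun y : ℝ => y ^ (1 : ℝ) * Real.exp (-(1 / 2) * y ^ (2 : ℝ))) |x| :=
    fun x => by
      simp only [gaussianPDFReal, smul_eq_mul, NNReal.coe_one, mul_one, sub_zero, Real.rpow_one,
        Real.rpow_two, sq_abs]
      ring_nf
  simp_rw [h1]
  rw [integral_const_mul, integral_comp_abs
    (f := fun y : ℝ => y ^ (1 : ℝ) * Real.exp (-(1 / 2) * y ^ (2 : ℝ))),
    integral_rpow_mul_exp_neg_mul_rpow (by norm_num) (by norm_num) (by norm_num)]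
  norm_num
  have : √Real.pi ≠ 0 := (Real.sqrt_pos.2 Real.pi_pos).ne'
  field_simp
  norm_num

lemma integrable_abs_gaussianReal : Integrable (fun x : ℝ => |x|) (gaussianReal 0 1) := by
  by_contra h
  have h1 := integral_abs_gaussianReal
  rw [integral_undef h] at h1
  exact (Real.sqrt_pos.2 (div_pos two_pos Real.pi_pos)).ne h1

lemma map_sum_mul_gaussianReal {ι : Type*} [Fintype ι] {c : ι → ℝ} (hc : ∑ i, c i ^ 2 = 1) :
    (Measure.pi fun _ : ι => gaussianReal 0 1).map (fun x => ∑ i, c i * x i)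
      = gaussianReal 0 1 := by
  have hm : Measurable fun x : ι → ℝ => ∑ i, c i * x i := by fun_prop
  have := Measure.isFiniteMeasure_map (Measure.pi fun _ : ι => gaussianReal 0 1)
    (fun x => ∑ i, c i * x i)
  refine Measure.ext_of_charFun (funext fun t => ?_)
  rw [charFun_apply_real, integral_map hm.aemeasurable (by fun_prop)]
  have h1 : ∀ x : ι → ℝ, Complex.exp (t * ((∑ i, c i * x i : ℝ) : ℂ) * Complex.I)
      = ∏ i, Complex.exp (((t * c i : ℝ) : ℂ) * (x i : ℂ) * Complex.I) := fun x => by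
    rw [← Complex.exp_sum]
    congr 1
    push_cast
    rw [mul_sum, sum_mul]
    exact sum_congr rfl fun i _ => by ring
  simp_rw [h1]
  rw [integral_fintype_prod_eq_prod (𝕜 := ℂ)
    (fun i (y : ℝ) => Complex.exp (((t * c i : ℝ) : ℂ) * (y : ℂ) * Complex.I))]
  simp_rw [← charFun_apply_real, charFun_gaussianReal]
  rw [← Complex.exp_sum]
  congr 1
  have h2 : (∑ i, ((c i : ℂ)) ^ 2) = 1 := by exact_mod_cast congrArg (fun r : ℝ => (r : ℂ)) hc
  have h3 : ∀ i, ((t * c i : ℝ) : ℂ) * ((0 : ℝ) : ℂ) * Complex.I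
      - ((1 : NNReal) : ℂ) * ((t * c i : ℝ) : ℂ) ^ 2 / 2 = - ((t : ℂ) ^ 2 / 2) * (c i : ℂ) ^ 2 :=
    fun i => by push_cast; ring
  rw [sum_congr rfl fun i _ => h3 i, ← mul_sum, h2]
  push_cast; ring

lemma integral_abs_sum_mul_gaussianReal {ι : Type*} [Fintype ι] {c : ι → ℝ}
    (hc : ∑ i, c i ^ 2 = 1) :
    ∫ x, |∑ i, c i * x i| ∂(Measure.pi fun _ : ι => gaussianReal 0 1) = √(2 / Real.pi) := by
  have hm : Measurable fun x : ι → ℝ => ∑ i, c i * x i := by fun_prop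
  have h := integral_map (μ := Measure.pi fun _ : ι => gaussianReal 0 1) hm.aemeasurable
    (f := fun x : ℝ => |x|) (by fun_prop)
  rw [← h, map_sum_mul_gaussianReal hc, integral_abs_gaussianReal]

variable {p : ℝ}

lemma isProbabilityMeasure_bernoulliGaussian (hp0 : 0 ≤ p) (hp1 : p ≤ 1) :
    IsProbabilityMeasure (bernoulliGaussian p) := by
  refine ⟨?_⟩
  simp only [bernoulliGaussian, Measure.add_apply, Measure.smul_apply, measure_univ]
  simp only [ENNReal.smul_def, smul_eq_mul, mul_one]
  rw [← ENNReal.coe_add, ← Real.toNNReal_add (by linarith) hp0]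
  simp

lemma integrable_bernoulliGaussian {f : ℝ → ℝ} (hf : Integrable f (gaussianReal 0 1)) :
    Integrable f (bernoulliGaussian p) :=
  (integrable_dirac (by simp)).smul_measure_nnreal.add_measure hf.smul_measure_nnreal

lemma integral_bernoulliGaussian (hp0 : 0 ≤ p) (hp1 : p ≤ 1) {f : ℝ → ℝ}
    (hf : Integrable f (gaussianReal 0 1)) :
    ∫ x, f x ∂(bernoulliGaussian p) = (1 - p) * f 0 + p * ∫ x, f x ∂(gaussianReal 0 1) := by
  rw [bernoulliGaussian, integral_add_measure (integrable_dirac (by simp)).smul_measure_nnreal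
    hf.smul_measure_nnreal, integral_smul_nnreal_measure, integral_smul_nnreal_measure,
    integral_dirac, NNReal.smul_def, NNReal.smul_def, Real.coe_toNNReal _ (by linarith),
    Real.coe_toNNReal _ hp0, smul_eq_mul, smul_eq_mul]

lemma integrable_abs_bernoulliGaussian : Integrable (fun x : ℝ => |x|) (bernoulliGaussian p) :=
  integrable_bernoulliGaussian integrable_abs_gaussianReal

lemma integrable_exp_mul_bernoulliGaussian (t : ℝ) :
    Integrable (fun x : ℝ => Real.exp (t * x)) (bernoulliGaussian p) :=
  integrable_bernoulliGaussian (integrable_exp_mul_gaussianReal t)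

lemma integral_exp_mul_gaussianReal (t : ℝ) :
    ∫ x, Real.exp (t * x) ∂(gaussianReal 0 1) = Real.exp (t ^ 2 / 2) := by
  have := congrFun (mgf_id_gaussianReal (μ := 0) (v := 1)) t
  simpa [mgf] using this

lemma integral_exp_mul_bernoulliGaussian_le (hp0 : 0 ≤ p) (hp1 : p ≤ 1) (t : ℝ) :
    ∫ x, Real.exp (t * x) ∂(bernoulliGaussian p) ≤ Real.exp (p * (Real.exp (t ^ 2 / 2) - 1)) := by
  rw [integral_bernoulliGaussian hp0 hp1 (integrable_exp_mul_gaussianReal t),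
    integral_exp_mul_gaussianReal, mul_zero, Real.exp_zero]
  refine le_trans (le_of_eq ?_) (Real.add_one_le_exp _)
  ring

lemma exp_abs_le (t x : ℝ) :
    Real.exp (t * |x|) ≤ Real.exp (t * x) + Real.exp (-t * x) - (1 - t * |x|) := by
  have h1 := Real.one_sub_le_exp_neg (t * |x|)
  rcases abs_cases x with ⟨h, _⟩ | ⟨h, _⟩ <;> rw [h] at h1 ⊢
  · rw [← neg_mul] at h1; linarith
  · have e1 : -(t * -x) = t * x := by ring
    have e2 : t * -x = -t * x := by ring
    rw [e1] at h1
    rw [e2] at h1 ⊢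
    linarith

lemma integrable_exp_mul_abs_bernoulliGaussian (t : ℝ) :
    Integrable (fun x : ℝ => Real.exp (t * |x|)) (bernoulliGaussian p) := by
  refine ((integrable_exp_mul_bernoulliGaussian t).add
    (integrable_exp_mul_bernoulliGaussian (-t))).mono' (by fun_prop) (ae_of_all _ fun x => ?_)
  rw [Real.norm_of_nonneg (Real.exp_pos _).le, Pi.add_apply]
  rcases abs_cases x with ⟨h, _⟩ | ⟨h, _⟩ <;> rw [h]
  · linarith [Real.exp_pos (-t * x)]
  · rw [mul_neg, ← neg_mul]; linarith [Real.exp_pos (t * x)]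

lemma exp_le_of_small {y : ℝ} (h0 : 0 ≤ y) (h1 : y ≤ 1 / 25) : Real.exp y - 1 ≤ 1.04 * y := by
  have := Real.abs_exp_sub_one_sub_id_le (x := y) (by rw [abs_of_nonneg h0]; linarith)
  have := (abs_le.1 this).2
  nlinarith

lemma integral_exp_mul_abs_bernoulliGaussian_le (hp0 : 0 ≤ p) (hp1 : p ≤ 1) {t : ℝ}
    (ht0 : 0 ≤ t) (ht : t ≤ 1 / 5) :
    ∫ x, Real.exp (t * |x|) ∂(bernoulliGaussian p)
      ≤ Real.exp (p * (t * √(2 / Real.pi) + 1.04 * t ^ 2)) := by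
  have hi1 := integrable_exp_mul_bernoulliGaussian (p := p) t
  have hi2 := integrable_exp_mul_bernoulliGaussian (p := p) (-t)
  have hi3 : Integrable (fun x : ℝ => 1 - t * |x|) (bernoulliGaussian p) :=
    (integrable_const _).sub (integrable_abs_bernoulliGaussian.const_mul t)
  have := isProbabilityMeasure_bernoulliGaussian hp0 hp1
  have habs : ∫ x, |x| ∂(bernoulliGaussian p) = p * √(2 / Real.pi) := by
    rw [integral_bernoulliGaussian hp0 hp1 integrable_abs_gaussianReal, integral_abs_gaussianReal]
    simp
  have hexp : ∀ s : ℝ, s ^ 2 = t ^ 2 → ∫ x, Real.exp (s * x) ∂(bernoulliGaussian p)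
      ≤ 1 + p * (0.52 * t ^ 2) := fun s hs => by
    rw [integral_bernoulliGaussian hp0 hp1 (integrable_exp_mul_gaussianReal s),
      integral_exp_mul_gaussianReal, mul_zero, Real.exp_zero, hs]
    have := exp_le_of_small (y := t ^ 2 / 2) (by positivity) (by nlinarith)
    nlinarith
  calc ∫ x, Real.exp (t * |x|) ∂(bernoulliGaussian p)
      ≤ ∫ x, (Real.exp (t * x) + Real.exp (-t * x) - (1 - t * |x|)) ∂(bernoulliGaussian p) :=
        integral_mono (integrable_exp_mul_abs_bernoulliGaussian t) ((hi1.add hi2).sub hi3)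
          fun x => exp_abs_le t x
    _ = ∫ x, Real.exp (t * x) ∂(bernoulliGaussian p) + ∫ x, Real.exp (-t * x) ∂(bernoulliGaussian p)
          - (1 - t * (p * √(2 / Real.pi))) := by
        rw [integral_sub (by exact hi1.add hi2) hi3, integral_add hi1 hi2,
          integral_sub (integrable_const _)
          (integrable_abs_bernoulliGaussian.const_mul t), integral_const_mul, habs]
        simp
    _ ≤ p * (t * √(2 / Real.pi) + 1.04 * t ^ 2) + 1 := by
        linarith [hexp t rfl, hexp (-t) (by ring)]
    _ ≤ _ := Real.add_one_le_exp _

lemma sqrt_two_div_pi_gt : 0.79 < √(2 / Real.pi) := by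
  refine Real.lt_sqrt_of_sq_lt ?_
  rw [lt_div_iff₀ Real.pi_pos]
  nlinarith [Real.pi_lt_d2]

lemma sqrt_two_div_pi_lt : √(2 / Real.pi) < 0.8 := by
  rw [Real.sqrt_lt' (by norm_num), div_lt_iff₀ Real.pi_pos]
  nlinarith [Real.pi_gt_d2]

/-- The Bernoulli measure of parameter `p` on `Bool`. -/
def coin (p : ℝ) : Measure Bool :=
  (1 - p).toNNReal • Measure.dirac false + p.toNNReal • Measure.dirac true

lemma isProbabilityMeasure_coin (hp0 : 0 ≤ p) (hp1 : p ≤ 1) : IsProbabilityMeasure (coin p) := by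
  refine ⟨?_⟩
  simp only [coin, Measure.add_apply, Measure.smul_apply, measure_univ]
  simp only [ENNReal.smul_def, smul_eq_mul, mul_one]
  rw [← ENNReal.coe_add, ← Real.toNNReal_add (by linarith) hp0]
  simp

lemma integral_coin (hp0 : 0 ≤ p) (hp1 : p ≤ 1) (f : Bool → ℝ) :
    ∫ b, f b ∂(coin p) = (1 - p) * f false + p * f true := by
  rw [coin, integral_add_measure (integrable_dirac (by simp)).smul_measure_nnreal
    (integrable_dirac (by simp)).smul_measure_nnreal, integral_smul_nnreal_measure,
    integral_smul_nnreal_measure, integral_dirac, integral_dirac, NNReal.smul_def, NNReal.smul_def,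
    Real.coe_toNNReal _ (by linarith), Real.coe_toNNReal _ hp0, smul_eq_mul, smul_eq_mul]

lemma measurable_mask : Measurable fun q : ℝ × Bool => if q.2 then q.1 else 0 :=
  Measurable.ite (measurable_snd (measurableSet_singleton true)) measurable_fst measurable_const

lemma measurable_pi_mask {ι : Type*} :
    Measurable fun (q : (ι → ℝ) × (ι → Bool)) i => if q.2 i then q.1 i else 0 := by
  refine measurable_pi_lambda _ fun i => ?_
  have h : Measurable fun q : (ι → ℝ) × (ι → Bool) => (q.1 i, q.2 i) := by fun_prop
  exact measurable_mask.comp h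

lemma map_mask (hp0 : 0 ≤ p) (hp1 : p ≤ 1) :
    ((gaussianReal 0 1).prod (coin p)).map (fun q => if q.2 then q.1 else 0)
      = bernoulliGaussian p := by
  have := isProbabilityMeasure_coin hp0 hp1
  ext s hs
  rw [Measure.map_apply measurable_mask hs, Measure.prod_apply_symm (measurable_mask hs)]
  conv_lhs => rw [coin]
  rw [lintegral_add_measure, lintegral_smul_measure, lintegral_smul_measure, lintegral_dirac,
    lintegral_dirac, bernoulliGaussian, Measure.add_apply, Measure.smul_apply, Measure.smul_apply]
  congr 2
  by_cases h : (0 : ℝ) ∈ s <;> simp [Measure.dirac_apply' _ hs, Set.preimage, h]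

lemma pi_bernoulliGaussian_eq_map {ι : Type*} [Fintype ι] (hp0 : 0 ≤ p) (hp1 : p ≤ 1) :
    ((Measure.pi fun _ : ι => gaussianReal 0 1).prod (Measure.pi fun _ : ι => coin p)).map
      (fun q i => if q.2 i then q.1 i else 0) = Measure.pi fun _ : ι => bernoulliGaussian p := by
  have := isProbabilityMeasure_coin hp0 hp1
  have h := measurePreserving_arrowProdEquivProdArrow ℝ Bool ι (fun _ => gaussianReal 0 1)
    (fun _ => coin p)
  rw [← h.map_eq, Measure.map_map ?_ h.measurable]
  · have hm : ∀ _ : ι, SigmaFinite (((gaussianReal 0 1).prod (coin p)).map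
        (fun q : ℝ × Bool => if q.2 then q.1 else 0)) := fun _ => by
      rw [map_mask hp0 hp1]; infer_instance
    have h2 := Measure.pi_map_pi (μ := fun _ : ι => (gaussianReal 0 1).prod (coin p))
      (f := fun _ (q : ℝ × Bool) => if q.2 then q.1 else 0) fun _ => measurable_mask.aemeasurable
    rw [map_mask hp0 hp1] at h2
    exact h2
  · exact measurable_pi_mask

lemma integral_coin_pair {ι : Type*} [Fintype ι] [DecidableEq ι] (hp0 : 0 ≤ p) (hp1 : p ≤ 1)
    {k l : ι} (hkl : l ≠ k) :
    ∫ b, (if b k then 0 else if b l then (1 : ℝ) else 0) ∂(Measure.pi fun _ : ι => coin p)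
      = (1 - p) * p := by
  have := isProbabilityMeasure_coin hp0 hp1
  have h1 : ∀ b : ι → Bool, (if b k then 0 else if b l then (1 : ℝ) else 0)
      = ∏ i, ((if i = k then if b i then 0 else 1 else 1)
        * (if i = l then if b i then 1 else 0 else 1)) := fun b => by
    rw [prod_mul_distrib, prod_ite_eq', prod_ite_eq', if_pos (mem_univ _), if_pos (mem_univ _)]
    split_ifs <;> simp
  simp_rw [h1]
  rw [integral_fintype_prod_eq_prod (𝕜 := ℝ) (fun i (b : Bool) =>
    (if i = k then if b then 0 else 1 else 1) * (if i = l then if b then 1 else 0 else 1))]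
  have h2 : ∀ i, ∫ b : Bool, ((if i = k then if b then 0 else 1 else 1)
      * (if i = l then if b then 1 else 0 else 1) : ℝ) ∂(coin p)
      = (if i = k then 1 - p else 1) * (if i = l then p else 1) := fun i => by
    rw [integral_coin hp0 hp1]
    rcases eq_or_ne i k with rfl | h
    · simp [hkl.symm]
    · rcases eq_or_ne i l with rfl | h' <;> simp [*]
  simp_rw [h2]
  rw [prod_mul_distrib, prod_ite_eq', prod_ite_eq', if_pos (mem_univ _), if_pos (mem_univ _)]

lemma integrable_abs_sum_mul {ι : Type*} [Fintype ι] {μ : Measure ℝ} [IsFiniteMeasure μ]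
    (hμ : Integrable (fun x : ℝ => |x|) μ) (c : ι → ℝ) :
    Integrable (fun x : ι → ℝ => |∑ l, c l * x l|) (Measure.pi fun _ : ι => μ) := by
  refine Integrable.abs (integrable_finsetSum _ fun l _ => Integrable.const_mul ?_ _)
  exact integrable_comp_eval (μ := fun _ : ι => μ) (i := l) (f := fun x => x)
    ((integrable_norm_iff measurable_id.aestronglyMeasurable).1 hμ)

lemma measurableSet_eval_eq_zero {ι : Type*} (k : ι) : MeasurableSet {x : ι → ℝ | x k = 0} :=
  measurable_pi_apply k (measurableSet_singleton 0)

lemma integrable_ite_abs_sum_mul {ι : Type*} [Fintype ι] (k : ι) (c : ι → ℝ) :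
    Integrable (fun x : ι → ℝ => if x k = 0 then |∑ l, c l * x l| else 0)
      (Measure.pi fun _ : ι => bernoulliGaussian p) :=
  (integrable_abs_sum_mul integrable_abs_bernoulliGaussian c).indicator
    (measurableSet_eval_eq_zero k)

/-- Jensen's inequality with respect to the Bernoulli mask. -/
lemma le_integral_ite_abs_sum_mul {ι : Type*} [Fintype ι] (hp0 : 0 ≤ p) (hp1 : p ≤ 1) {k : ι}
    {c : ι → ℝ} (hck : c k = 0) (hc : ∑ l, c l ^ 2 = 1) :
    (1 - p) * p * √(2 / Real.pi) ≤ ∫ x, (if x k = 0 then |∑ l, c l * x l| else 0)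
      ∂(Measure.pi fun _ : ι => bernoulliGaussian p) := by
  classical
  have := isProbabilityMeasure_coin hp0 hp1
  have hF := integrable_ite_abs_sum_mul (p := p) k c
  have hmeas := measurable_pi_mask (ι := ι)
  rw [← pi_bernoulliGaussian_eq_map hp0 hp1] at hF ⊢
  rw [integral_map hmeas.aemeasurable hF.aestronglyMeasurable]
  have hF2 := hF.comp_measurable hmeas
  refine le_trans ?_ (integral_prod _ hF2).ge
  rw [← integral_abs_sum_mul_gaussianReal hc, ← integral_const_mul]
  refine integral_mono ((integrable_abs_sum_mul integrable_abs_gaussianReal c).const_mul _)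
    hF2.integral_prod_left fun g => ?_
  have hmean : ∫ b, (if b k then 0 else ∑ l, c l * if b l then g l else 0)
      ∂(Measure.pi fun _ : ι => coin p) = (1 - p) * p * ∑ l, c l * g l := by
    have h1 : ∀ b : ι → Bool, (if b k then 0 else ∑ l, c l * if b l then g l else 0)
        = ∑ l, c l * g l * (if b k then 0 else if b l then (1 : ℝ) else 0) := fun b => by
      split_ifs
      · simp
      · exact sum_congr rfl fun l _ => by split_ifs <;> ring
    simp_rw [h1]
    rw [integral_finsetSum _ fun l _ => Integrable.of_finite, mul_sum]
    refine sum_congr rfl fun l _ => ?_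
    rw [integral_const_mul]
    rcases eq_or_ne l k with rfl | h
    · simp [hck]
    · rw [integral_coin_pair hp0 hp1 h]; ring
  have hq : 0 ≤ (1 - p) * p := mul_nonneg (by linarith) hp0
  calc (1 - p) * p * |∑ l, c l * g l|
      = |∫ b, (if b k then 0 else ∑ l, c l * if b l then g l else 0)
          ∂(Measure.pi fun _ : ι => coin p)| := by rw [hmean, abs_mul, abs_of_nonneg hq]
    _ ≤ ∫ b, |if b k then 0 else ∑ l, c l * if b l then g l else 0|
          ∂(Measure.pi fun _ : ι => coin p) := abs_integral_le_integral_abs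
    _ ≤ _ := by
      refine integral_mono Integrable.of_finite Integrable.of_finite fun b => ?_
      dsimp only [Function.comp]
      by_cases hb : b k
      · rw [if_pos hb, abs_zero]
        split_ifs
        exacts [abs_nonneg _, le_rfl]
      · rw [if_neg hb, if_pos (if_neg hb)]

lemma measurable_absDeriv : Measurable fun q : ℝ × ℝ => absDeriv q.1 q.2 := by
  have hs : Measurable Real.sign :=
    Measurable.ite measurableSet_Iio measurable_const
      (Measurable.ite measurableSet_Ioi measurable_const measurable_const)
  exact Measurable.ite (measurable_fst (measurableSet_singleton 0)) (by fun_prop)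
    ((hs.comp measurable_fst).mul measurable_snd)

/-- The weight `1_{z < 0} + 1_{z = 0} / 2`. -/
def negWeight (z : ℝ) : ℝ := if z = 0 then 1 / 2 else if z < 0 then 1 else 0

lemma negWeight_nonneg (z : ℝ) : 0 ≤ negWeight z := by
  unfold negWeight; split_ifs <;> norm_num

lemma negWeight_le_one (z : ℝ) : negWeight z ≤ 1 := by
  unfold negWeight; split_ifs <;> norm_num

lemma negWeight_add_neg (z : ℝ) : negWeight z + negWeight (-z) = 1 := by
  unfold negWeight
  rcases lt_trichotomy z 0 with h | rfl | h
  · simp [h, h.ne, h.le]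
  · norm_num
  · simp [h, h.ne', h.le]

lemma measurable_negWeight : Measurable negWeight :=
  Measurable.ite (measurableSet_singleton 0) measurable_const
    (Measurable.ite measurableSet_Iio measurable_const measurable_const)

lemma exp_neg_mul_absDeriv_le {t : ℝ} (ht : 0 ≤ t) (z v : ℝ) :
    Real.exp (-t * absDeriv z v) ≤ negWeight z * Real.exp (t * v)
      + negWeight (-z) * Real.exp (-t * v) - t * (if z = 0 then |v| else 0) := by
  unfold absDeriv negWeight
  rcases lt_trichotomy z 0 with h | rfl | h
  · simp [h, h.ne, h.not_gt, Real.sign_of_neg]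
  · have h1 := Real.self_le_sinh_iff.2 (mul_nonneg ht (abs_nonneg v))
    rw [Real.sinh_eq] at h1
    rcases abs_cases v with ⟨h2, _⟩ | ⟨h2, _⟩ <;> rw [h2] at h1 <;> simp [h2] at * <;> linarith
  · simp [h, h.ne', h.not_gt, Real.sign_of_pos]

section Column

variable {ι : Type*} [Fintype ι]

lemma integrable_eval_mul_exp {g : ℝ → ℝ} (hg : Integrable g (bernoulliGaussian p)) {k : ι}
    {c : ι → ℝ} (hck : c k = 0) (t : ℝ) :
    Integrable (fun x : ι → ℝ => g (x k) * Real.exp (t * ∑ l, c l * x l))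
      (Measure.pi fun _ : ι => bernoulliGaussian p) := by
  classical
  have h1 : ∀ x : ι → ℝ, g (x k) * Real.exp (t * ∑ l, c l * x l)
      = ∏ l, ((if l = k then g (x l) else 1) * Real.exp (t * c l * x l)) := fun x => by
    rw [prod_mul_distrib, prod_ite_eq', if_pos (mem_univ _), ← Real.exp_sum, mul_sum]
    simp_rw [mul_assoc]
  simp_rw [h1]
  refine Integrable.fintype_prod (f := fun l y =>
    (if l = k then g y else 1) * Real.exp (t * c l * y)) fun l => ?_
  rcases eq_or_ne l k with rfl | h
  · simpa [hck] using hg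
  · simpa [h] using integrable_exp_mul_bernoulliGaussian (t * c l)

lemma integral_eval_mul_exp_le (hp0 : 0 ≤ p) (hp1 : p ≤ 1) {g : ℝ → ℝ} (hg0 : ∀ y, 0 ≤ g y)
    {k : ι} {c : ι → ℝ} (hck : c k = 0) (hc : ∑ l, c l ^ 2 = 1) {t : ℝ} (ht : |t| ≤ 1 / 5) :
    ∫ x, g (x k) * Real.exp (t * ∑ l, c l * x l) ∂(Measure.pi fun _ : ι => bernoulliGaussian p)
      ≤ (∫ y, g y ∂(bernoulliGaussian p)) * Real.exp (0.52 * p * t ^ 2) := by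
  classical
  have h1 : ∀ x : ι → ℝ, g (x k) * Real.exp (t * ∑ l, c l * x l)
      = ∏ l, ((if l = k then g (x l) else 1) * Real.exp (t * c l * x l)) := fun x => by
    rw [prod_mul_distrib, prod_ite_eq', if_pos (mem_univ _), ← Real.exp_sum, mul_sum]
    simp_rw [mul_assoc]
  have hsq : t ^ 2 ≤ 1 / 25 := by
    rw [← sq_abs]; nlinarith [abs_nonneg t]
  have hcl : ∀ l, c l ^ 2 ≤ 1 := fun l =>
    (single_le_sum (f := fun l => c l ^ 2) (fun l _ => sq_nonneg _) (mem_univ l)).trans_eq hc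
  have hfac : ∀ l, ∫ y, (if l = k then g y else 1) * Real.exp (t * c l * y)
      ∂(bernoulliGaussian p) ≤ (if l = k then ∫ y, g y ∂(bernoulliGaussian p) else 1)
        * Real.exp (0.52 * p * t ^ 2 * c l ^ 2) := fun l => by
    rcases eq_or_ne l k with rfl | h
    · simp [hck]
    · simp only [if_neg h, one_mul]
      refine (integral_exp_mul_bernoulliGaussian_le hp0 hp1 _).trans (Real.exp_le_exp.2 ?_)
      have h2 := exp_le_of_small (y := (t * c l) ^ 2 / 2) (by positivity) (by
        rw [mul_pow]; nlinarith [hcl l, sq_nonneg t, sq_nonneg (c l)])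
      nlinarith [mul_le_mul_of_nonneg_left h2 hp0]
  simp_rw [h1]
  rw [integral_fintype_prod_eq_prod (𝕜 := ℝ) fun l y =>
    (if l = k then g y else 1) * Real.exp (t * c l * y)]
  refine (prod_le_prod (fun l _ => integral_nonneg fun y => ?_) fun l _ => hfac l).trans_eq ?_
  · refine mul_nonneg ?_ (Real.exp_pos _).le
    split_ifs
    exacts [hg0 y, zero_le_one]
  · rw [prod_mul_distrib, prod_ite_eq', if_pos (mem_univ _), ← Real.exp_sum, ← mul_sum, hc, mul_one]

lemma integrable_negWeight : Integrable negWeight (bernoulliGaussian p) :=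
  (integrable_const (1 : ℝ)).mono' measurable_negWeight.aestronglyMeasurable
    (ae_of_all _ fun y => by
      rw [Real.norm_of_nonneg (negWeight_nonneg y)]; exact negWeight_le_one y)

lemma integrable_negWeight_neg : Integrable (fun y => negWeight (-y)) (bernoulliGaussian p) :=
  (integrable_const (1 : ℝ)).mono' (measurable_negWeight.comp measurable_neg).aestronglyMeasurable
    (ae_of_all _ fun y => by
      rw [Real.norm_of_nonneg (negWeight_nonneg _)]; exact negWeight_le_one _)

lemma integrable_exp_neg_mul_absDeriv {k : ι} {c : ι → ℝ} (hck : c k = 0) {t : ℝ} (ht : 0 ≤ t) :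
    Integrable (fun x : ι → ℝ => Real.exp (-t * absDeriv (x k) (∑ l, c l * x l)))
      (Measure.pi fun _ : ι => bernoulliGaussian p) := by
  refine (((integrable_eval_mul_exp integrable_negWeight hck t).add
    (integrable_eval_mul_exp integrable_negWeight_neg hck (-t))).sub
      ((integrable_ite_abs_sum_mul k c).const_mul t)).mono' ?_ (ae_of_all _ fun x => ?_)
  · have h : Measurable fun x : ι → ℝ => (x k, ∑ l, c l * x l) := by fun_prop
    exact (Real.measurable_exp.comp
      ((measurable_absDeriv.comp h).const_mul (-t))).aestronglyMeasurable
  · rw [Real.norm_of_nonneg (Real.exp_pos _).le]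
    exact exp_neg_mul_absDeriv_le ht _ _

lemma integral_exp_neg_mul_absDeriv_le (hp0 : 0 ≤ p) (hp1 : p ≤ 1) {k : ι} {c : ι → ℝ}
    (hck : c k = 0) (hc : ∑ l, c l ^ 2 = 1) {t : ℝ} (ht0 : 0 ≤ t) (ht : t ≤ 1 / 5) :
    ∫ x, Real.exp (-t * absDeriv (x k) (∑ l, c l * x l))
      ∂(Measure.pi fun _ : ι => bernoulliGaussian p)
      ≤ Real.exp (p * (0.55 * t ^ 2 - t * (1 - p) * √(2 / Real.pi))) := by
  have := isProbabilityMeasure_bernoulliGaussian hp0 hp1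
  have hi1 := integrable_eval_mul_exp (p := p) integrable_negWeight hck t
  have hi2 := integrable_eval_mul_exp (p := p) integrable_negWeight_neg hck (-t)
  have hi3 := (integrable_ite_abs_sum_mul (p := p) k c).const_mul t
  have h1 := integral_eval_mul_exp_le hp0 hp1 negWeight_nonneg hck hc
    (t := t) (by rwa [abs_of_nonneg ht0])
  have h2 := integral_eval_mul_exp_le hp0 hp1 (fun y => negWeight_nonneg (-y)) hck hc
    (t := -t) (by rwa [abs_neg, abs_of_nonneg ht0])
  have h3 := mul_le_mul_of_nonneg_left (le_integral_ite_abs_sum_mul hp0 hp1 hck hc) ht0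
  have h4 : (∫ y, negWeight y ∂(bernoulliGaussian p)) + ∫ y, negWeight (-y) ∂(bernoulliGaussian p)
      = 1 := by
    rw [← integral_add integrable_negWeight integrable_negWeight_neg]
    simp [negWeight_add_neg]
  have h5 := integral_mono (integrable_exp_neg_mul_absDeriv (p := p) hck ht0)
    ((hi1.add hi2).sub hi3) fun x => exp_neg_mul_absDeriv_le ht0 _ _
  rw [integral_sub' (hi1.add hi2) hi3, integral_add' hi1 hi2, integral_const_mul] at h5
  rw [neg_sq] at h2
  have ht2 : t ^ 2 ≤ 1 / 25 := by nlinarith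
  have h6 := exp_le_of_small (y := 0.52 * p * t ^ 2) (by positivity) (by nlinarith [sq_nonneg t])
  refine le_trans ?_ (Real.add_one_le_exp _)
  have h7 : (∫ y, negWeight y ∂(bernoulliGaussian p)) * Real.exp (0.52 * p * t ^ 2)
      + (∫ y, negWeight (-y) ∂(bernoulliGaussian p)) * Real.exp (0.52 * p * t ^ 2)
      = Real.exp (0.52 * p * t ^ 2) := by rw [← add_mul, h4, one_mul]
  nlinarith [mul_nonneg hp0 (sq_nonneg t)]

end Column

section Tensor

variable {ι κ : Type*} [Fintype ι] [Fintype κ]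

/-- A matrix with i.i.d. entries has i.i.d. columns. -/
lemma map_uncurry_pi (μ : Measure ℝ) [IsProbabilityMeasure μ] :
    (Measure.pi fun _ : κ => Measure.pi fun _ : ι => μ).map (fun x (q : ι × κ) => x q.2 q.1)
      = Measure.pi fun _ : ι × κ => μ := by
  have hm : Measurable fun (x : κ → ι → ℝ) (q : ι × κ) => x q.2 q.1 :=
    measurable_pi_lambda _ fun q => by fun_prop
  refine (Measure.pi_eq fun s hs => ?_).symm
  rw [Measure.map_apply hm (MeasurableSet.univ_pi hs)]
  have h : (fun (x : κ → ι → ℝ) (q : ι × κ) => x q.2 q.1) ⁻¹' Set.univ.pi s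
      = Set.univ.pi fun n => Set.univ.pi fun l => s (l, n) := by
    ext x
    simp only [Set.mem_preimage, Set.mem_univ_pi, Prod.forall]
    exact forall_comm
  rw [h, Measure.pi_pi]
  simp_rw [Measure.pi_pi]
  rw [Fintype.prod_prod_type_right]

lemma integrable_prod_column {μ : Measure ℝ} [IsProbabilityMeasure μ] {f : (ι → ℝ) → ℝ}
    (hf : Integrable f (Measure.pi fun _ : ι => μ)) (hfm : Measurable f) :
    Integrable (fun ω : ι × κ → ℝ => ∏ n, f fun l => ω (l, n)) (Measure.pi fun _ : ι × κ => μ) := by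
  have hm : Measurable fun (x : κ → ι → ℝ) (q : ι × κ) => x q.2 q.1 :=
    measurable_pi_lambda _ fun q => by fun_prop
  rw [← map_uncurry_pi, integrable_map_measure (Measurable.aestronglyMeasurable ?_) hm.aemeasurable]
  · exact Integrable.fintype_prod (f := fun _ : κ => f) fun _ => hf
  · exact Finset.measurable_prod _ fun n _ => hfm.comp (by fun_prop)

lemma integral_prod_column {μ : Measure ℝ} [IsProbabilityMeasure μ] {f : (ι → ℝ) → ℝ}
    (hfm : Measurable f) :
    ∫ ω, ∏ n, f (fun l => ω (l, n)) ∂(Measure.pi fun _ : ι × κ => μ)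
      = (∫ x, f x ∂(Measure.pi fun _ : ι => μ)) ^ Fintype.card κ := by
  have hm : Measurable fun (x : κ → ι → ℝ) (q : ι × κ) => x q.2 q.1 :=
    measurable_pi_lambda _ fun q => by fun_prop
  rw [← map_uncurry_pi, integral_map hm.aemeasurable (Measurable.aestronglyMeasurable ?_)]
  · exact integral_fintype_prod_eq_pow (ι := κ) f
  · exact Finset.measurable_prod _ fun n _ => hfm.comp (by fun_prop)

lemma measurable_absDeriv_column (k : ι) (c : ι → ℝ) :
    Measurable fun x : ι → ℝ => absDeriv (x k) (∑ l, c l * x l) := by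
  have h : Measurable fun x : ι → ℝ => (x k, ∑ l, c l * x l) := by fun_prop
  exact measurable_absDeriv.comp h

lemma measureReal_sum_absDeriv_le (hp0 : 0 ≤ p) (hp1 : p ≤ 1) {k : ι} {c : ι → ℝ}
    (hck : c k = 0) (hc : ∑ l, c l ^ 2 = 1) {t : ℝ} (ht0 : 0 ≤ t) (ht : t ≤ 1 / 5) :
    (Measure.pi fun _ : ι × κ => bernoulliGaussian p).real
      {ω | ∑ n, absDeriv (ω (k, n)) (∑ l, c l * ω (l, n))
        ≤ Fintype.card κ * p * ((1 - p) * √(2 / Real.pi) - 1.2 * t)}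
      ≤ Real.exp (-(Fintype.card κ * p * t ^ 2 / 2)) := by
  have := isProbabilityMeasure_bernoulliGaussian hp0 hp1
  have hfm : Measurable fun x : ι → ℝ => Real.exp (-t * absDeriv (x k) (∑ l, c l * x l)) :=
    Real.measurable_exp.comp ((measurable_absDeriv_column k c).const_mul (-t))
  have hexp : ∀ ω : ι × κ → ℝ,
      Real.exp (-t * ∑ n, absDeriv (ω (k, n)) (∑ l, c l * ω (l, n)))
        = ∏ n, Real.exp (-t * absDeriv (ω (k, n)) (∑ l, c l * ω (l, n))) := fun ω => by
    rw [← Real.exp_sum, mul_sum]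
  have hint := integrable_prod_column (κ := κ)
    (integrable_exp_neg_mul_absDeriv (p := p) hck ht0) hfm
  refine (measure_le_le_exp_mul_mgf _ (neg_nonpos.2 ht0) (by simpa only [hexp] using hint)).trans ?_
  rw [mgf]
  simp_rw [hexp]
  rw [integral_prod_column (κ := κ) hfm]
  have h1 := pow_le_pow_left₀ (integral_nonneg fun x => (Real.exp_pos _).le)
    (integral_exp_neg_mul_absDeriv_le hp0 hp1 hck hc ht0 ht) (Fintype.card κ)
  rw [← Real.exp_nat_mul] at h1
  refine (mul_le_mul_of_nonneg_left h1 (Real.exp_pos _).le).trans ?_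
  rw [← Real.exp_add, Real.exp_le_exp]
  have h2 : 0 ≤ Fintype.card κ * p * t ^ 2 := by positivity
  linarith

lemma measureReal_sum_abs_ge (hp0 : 0 ≤ p) (hp1 : p ≤ 1) (k : ι) {t : ℝ} (ht0 : 0 ≤ t)
    (ht : t ≤ 1 / 5) :
    (Measure.pi fun _ : ι × κ => bernoulliGaussian p).real
      {ω | Fintype.card κ * p * ((1 + 2 * t) * √(2 / Real.pi)) ≤ ∑ n, |ω (k, n)|}
      ≤ Real.exp (-(Fintype.card κ * p * t ^ 2 / 2)) := by
  have := isProbabilityMeasure_bernoulliGaussian hp0 hp1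
  have hfm : Measurable fun x : ι → ℝ => Real.exp (t * |x k|) := by fun_prop
  have hexp : ∀ ω : ι × κ → ℝ, Real.exp (t * ∑ n, |ω (k, n)|)
        = ∏ n, Real.exp (t * |ω (k, n)|) := fun ω => by
    rw [← Real.exp_sum, mul_sum]
  have hint1 : Integrable (fun x : ι → ℝ => Real.exp (t * |x k|))
      (Measure.pi fun _ : ι => bernoulliGaussian p) :=
    integrable_comp_eval (μ := fun _ : ι => bernoulliGaussian p) (i := k)
      (f := fun y => Real.exp (t * |y|)) (integrable_exp_mul_abs_bernoulliGaussian t)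
  have hint := integrable_prod_column (κ := κ) hint1 hfm
  refine (measure_ge_le_exp_mul_mgf _ ht0 (by simpa only [hexp] using hint)).trans ?_
  rw [mgf]
  simp_rw [hexp]
  rw [integral_prod_column (κ := κ) hfm]
  have hcol : ∫ x : ι → ℝ, Real.exp (t * |x k|) ∂(Measure.pi fun _ : ι => bernoulliGaussian p)
      = ∫ y, Real.exp (t * |y|) ∂(bernoulliGaussian p) :=
    integral_comp_eval (μ := fun _ : ι => bernoulliGaussian p) (i := k)
      (f := fun y => Real.exp (t * |y|))
      (integrable_exp_mul_abs_bernoulliGaussian t).aestronglyMeasurable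
  have h1 := pow_le_pow_left₀ (integral_nonneg fun x => (Real.exp_pos _).le)
    (integral_exp_mul_abs_bernoulliGaussian_le hp0 hp1 ht0 ht) (Fintype.card κ)
  rw [hcol]
  rw [← Real.exp_nat_mul] at h1
  refine (mul_le_mul_of_nonneg_left h1 (Real.exp_pos _).le).trans ?_
  rw [← Real.exp_add, Real.exp_le_exp]
  have h2 : 0 ≤ Fintype.card κ * p * t ^ 2 := by positivity
  nlinarith [sqrt_two_div_pi_gt]

end Tensor

end Gaussian

/-- A subset of the unit ball has a finite `δ`-net of cardinality at most `(1 + 2 / δ) ^ dim`. -/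
lemma exists_finset_net {E : Type*} [NormedAddCommGroup E] [NormedSpace ℝ E]
    [FiniteDimensional ℝ E] {A : Set E} (hA : ∀ x ∈ A, ‖x‖ ≤ 1) {δ : ℝ} (hδ : 0 < δ) :
    ∃ T : Finset E, (∀ y ∈ T, y ∈ A) ∧ (∀ x ∈ A, ∃ y ∈ T, ‖x - y‖ ≤ δ) ∧
      (T.card : ℝ) ≤ (1 + 2 / δ) ^ Module.finrank ℝ E := by
  classical
  set P : Finset E → Prop := fun T => (∀ y ∈ T, y ∈ A) ∧
    ∀ y ∈ T, ∀ z ∈ T, y ≠ z → δ ≤ ‖y - z‖ with hP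
  have hcard : ∀ T, P T → (T.card : ℝ) ≤ (1 + 2 / δ) ^ Module.finrank ℝ E := by
    rintro T ⟨hTA, hTsep⟩
    borelize E
    let μ : Measure E := Measure.addHaar
    have hδ2 : 0 < δ / 2 := half_pos hδ
    have hρ : 0 < 1 + δ / 2 := by positivity
    have D : Set.Pairwise (T : Set E) (Function.onFun Disjoint fun c => Metric.ball c (δ / 2)) := by
      intro c hc d hd hcd
      apply Metric.ball_disjoint_ball
      rw [dist_eq_norm, add_halves]
      exact hTsep c hc d hd hcd
    have hsub : (⋃ c ∈ T, Metric.ball c (δ / 2)) ⊆ Metric.ball (0 : E) (1 + δ / 2) := by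
      refine Set.iUnion₂_subset fun x hx => Metric.ball_subset_ball' ?_
      rw [dist_zero_right, add_comm]
      exact add_le_add (hA x (hTA x hx)) le_rfl
    have hvol : (T.card : ENNReal) * ENNReal.ofReal ((δ / 2) ^ Module.finrank ℝ E)
        * μ (Metric.ball 0 1)
        ≤ ENNReal.ofReal ((1 + δ / 2) ^ Module.finrank ℝ E) * μ (Metric.ball 0 1) :=
      calc _ = μ (⋃ c ∈ T, Metric.ball c (δ / 2)) := by
            rw [measure_biUnion_finset D fun c _ => measurableSet_ball]
            simp only [μ.addHaar_ball_of_pos _ hδ2, Finset.sum_const, nsmul_eq_mul, mul_assoc]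
        _ ≤ _ := measure_mono hsub
        _ = _ := μ.addHaar_ball_of_pos _ hρ
    have hle := (ENNReal.mul_le_mul_iff_left (Metric.measure_ball_pos μ _ zero_lt_one).ne'
      measure_ball_lt_top.ne).1 hvol
    have hreal := ENNReal.toReal_le_of_le_ofReal (by positivity) hle
    rw [ENNReal.toReal_mul, ENNReal.toReal_natCast, ENNReal.toReal_ofReal (by positivity)] at hreal
    have hsplit : 1 + δ / 2 = (1 + 2 / δ) * (δ / 2) := by field_simp; ring
    rw [hsplit, mul_pow] at hreal
    exact le_of_mul_le_mul_right hreal (by positivity)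
  obtain ⟨M, hM⟩ := exists_nat_ge ((1 + 2 / δ) ^ Module.finrank ℝ E)
  have hex : ∃ n, ∃ T, P T ∧ T.card = n := ⟨0, ∅, by simp [hP], rfl⟩
  have hbdd : ∀ n, (∃ T, P T ∧ T.card = n) → n ≤ M := by
    rintro n ⟨T, hT, rfl⟩
    exact_mod_cast (hcard T hT).trans hM
  obtain ⟨T, hT, hTn⟩ := Nat.findGreatest_spec (P := fun n => ∃ T, P T ∧ T.card = n)
    (hbdd _ hex.choose_spec) hex.choose_spec
  refine ⟨T, hT.1, fun x hx => ?_, hcard T hT⟩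
  by_contra! hcon
  have hxT : x ∉ T := fun h => by simpa using (hcon x h).trans_le' hδ.le
  have hins : P (insert x T) := by
    refine ⟨fun y hy => ?_, fun y hy z hz hyz => ?_⟩
    · rcases mem_insert.1 hy with rfl | hyT
      exacts [hx, hT.1 y hyT]
    · rcases mem_insert.1 hy with rfl | hyT <;> rcases mem_insert.1 hz with rfl | hzT
      · exact absurd rfl hyz
      · exact (hcon z hzT).le
      · rw [norm_sub_rev]; exact (hcon y hyT).le
      · exact hT.2 y hyT z hzT hyz
  have := Nat.le_findGreatest (P := fun n => ∃ T, P T ∧ T.card = n)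
    (hbdd _ ⟨_, hins, rfl⟩) ⟨_, hins, rfl⟩
  rw [card_insert_of_notMem hxT] at this
  omega

/-- Coordinate version of `exists_finset_net` for the unit vectors with vanishing `k`-th entry. -/
lemma exists_finset_net_unit {K : ℕ} (k : Fin K) {δ : ℝ} (hδ : 0 < δ) :
    ∃ T : Finset (Fin K → ℝ), (∀ c ∈ T, c k = 0 ∧ ∑ l, c l ^ 2 = 1) ∧
      (∀ c : Fin K → ℝ, c k = 0 → ∑ l, c l ^ 2 = 1 → ∃ d ∈ T, ∑ l, (c l - d l) ^ 2 ≤ δ ^ 2) ∧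
      (T.card : ℝ) ≤ (1 + 2 / δ) ^ K := by
  classical
  obtain ⟨T, hTA, hnet, hcard⟩ := exists_finset_net
    (A := {x : EuclideanSpace ℝ (Fin K) | x k = 0 ∧ ∑ l, x l ^ 2 = 1})
    (fun x hx => by rw [EuclideanSpace.norm_eq]; simp [hx.2]) hδ
  refine ⟨T.image fun x l => x l, fun c hc => ?_, fun c hc0 hc1 => ?_, ?_⟩
  · obtain ⟨x, hx, rfl⟩ := mem_image.1 hc
    exact hTA x hx
  · obtain ⟨y, hy, hxy⟩ := hnet (WithLp.toLp 2 c) ⟨hc0, hc1⟩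
    refine ⟨fun l => y l, mem_image_of_mem _ hy, ?_⟩
    rw [EuclideanSpace.norm_eq] at hxy
    have := (Real.sqrt_le_iff.1 hxy).2
    simpa using this
  · refine le_trans (by exact_mod_cast card_image_le) (hcard.trans ?_)
    simp

lemma sum_abs_le_sqrt_mul {K : ℕ} {a : Fin K → ℝ} {b : ℝ} (hb : 0 ≤ b)
    (ha : ∑ l, a l ^ 2 ≤ b ^ 2) : ∑ l, |a l| ≤ √K * b := by
  refine (Real.le_sqrt_of_sq_le ?_ : _ ≤ √(K * b ^ 2)).trans_eq ?_
  · have h := sq_sum_le_card_mul_sum_sq (s := univ) (f := fun l => |a l|)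
    simp only [sq_abs, card_univ, Fintype.card_fin] at h
    exact h.trans (mul_le_mul_of_nonneg_left ha (Nat.cast_nonneg K))
  · rw [Real.sqrt_mul (Nat.cast_nonneg K), Real.sqrt_sq hb]

lemma sqrt_sum_gram_le_mu2 {d K : ℕ} (D₀ : Matrix (Fin d) (Fin K) ℝ) (k : Fin K) :
    √(∑ l ∈ univ.erase k, (∑ i, D₀ i l * D₀ i k) ^ 2) ≤ mu2 D₀ :=
  le_ciSup (f := fun k => √(∑ l ∈ univ.erase k, (∑ i, D₀ i l * D₀ i k) ^ 2))
    (Set.finite_range _).bddAbove k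

lemma sum_mul_gram_mul_le {d K : ℕ} (D₀ : Matrix (Fin d) (Fin K) ℝ) {k : Fin K} {c s : Fin K → ℝ}
    (hck : c k = 0) (hc : ∑ l, c l ^ 2 = 1) {M : ℝ} (hs0 : ∀ l, 0 ≤ s l) (hs : ∀ l, s l ≤ M) :
    ∑ l, c l * ((∑ i, D₀ i l * D₀ i k) * s l) ≤ mu2 D₀ * M := by
  have hM : 0 ≤ M := (hs0 k).trans (hs k)
  rw [← add_sum_erase _ _ (mem_univ k), hck, zero_mul, zero_add]
  refine (Real.sum_mul_le_sqrt_mul_sqrt _ _ _).trans ?_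
  have h1 : √(∑ l ∈ univ.erase k, c l ^ 2) = 1 := by
    rw [← add_sum_erase _ _ (mem_univ k), hck] at hc
    rw [show ∑ l ∈ univ.erase k, c l ^ 2 = 1 by linarith, Real.sqrt_one]
  rw [h1, one_mul]
  calc √(∑ l ∈ univ.erase k, ((∑ i, D₀ i l * D₀ i k) * s l) ^ 2)
      ≤ √((∑ l ∈ univ.erase k, (∑ i, D₀ i l * D₀ i k) ^ 2) * M ^ 2) := by
        refine Real.sqrt_le_sqrt ?_
        rw [sum_mul]
        refine sum_le_sum fun l _ => ?_
        rw [mul_pow]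
        have := hs0 l
        gcongr
        exact hs l
    _ ≤ mu2 D₀ * M := by
        rw [Real.sqrt_mul (sum_nonneg fun _ _ => sq_nonneg _), Real.sqrt_sq hM]
        exact mul_le_mul_of_nonneg_right (sqrt_sum_gram_le_mu2 D₀ k) hM

lemma sum_absDeriv_sub_le {K N : ℕ} (X : Matrix (Fin K) (Fin N) ℝ) (k : Fin K)
    (c d : Fin K → ℝ) {M : ℝ} (hM : ∀ l, ∑ n, |X l n| ≤ M) :
    ∑ n, absDeriv (X k n) (∑ l, d l * X l n)
      ≤ ∑ n, absDeriv (X k n) (∑ l, c l * X l n) + (∑ l, |c l - d l|) * M := by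
  have h1 : ∀ n, absDeriv (X k n) (∑ l, d l * X l n) ≤ absDeriv (X k n) (∑ l, c l * X l n)
      + ∑ l, |c l - d l| * |X l n| := fun n => by
    have h2 := (abs_le.1 (abs_absDeriv_sub_le (X k n) (∑ l, c l * X l n) (∑ l, d l * X l n))).1
    have h3 : |∑ l, c l * X l n - ∑ l, d l * X l n| ≤ ∑ l, |c l - d l| * |X l n| := by
      rw [← sum_sub_distrib]
      refine (abs_sum_le_sum_abs _ _).trans_eq (sum_congr rfl fun l _ => ?_)
      rw [← sub_mul, abs_mul]
    linarith
  refine (sum_le_sum fun n _ => h1 n).trans ?_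
  rw [sum_add_distrib, sum_comm, sum_mul]
  gcongr with l
  rw [← mul_sum]
  exact mul_le_mul_of_nonneg_left (hM l) (abs_nonneg _)

/-- A lower bound for the directional derivatives at the points of a `δ`-net of the unit sphere
of `{c | c k = 0}` extends to all `c`. -/
lemma gap_of_net {d K N : ℕ} (D₀ : Matrix (Fin d) (Fin K) ℝ) (X : Matrix (Fin K) (Fin N) ℝ)
    {k : Fin K} {T : Set (Fin K → ℝ)} {δ η M τ : ℝ} (hδ : 0 ≤ δ) (hη : 0 ≤ η)
    (hT : ∀ c : Fin K → ℝ, c k = 0 → ∑ l, c l ^ 2 = 1 → ∃ d ∈ T, ∑ l, (c l - d l) ^ 2 ≤ δ ^ 2)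
    (hM : ∀ l, ∑ n, |X l n| ≤ M) (hτ : ∀ d ∈ T, τ ≤ ∑ n, absDeriv (X k n) (∑ l, d l * X l n))
    (hgap : η * √K + √K * δ * M + mu2 D₀ * M ≤ τ) {c : Fin K → ℝ} (hck : c k = 0) :
    η * ∑ l, |c l| + ∑ l, c l * ((∑ i, D₀ i l * D₀ i k) * ∑ n, |X l n|)
      ≤ ∑ n, absDeriv (X k n) (∑ l, c l * X l n) := by
  have hX0 : ∀ l, 0 ≤ ∑ n, |X l n| := fun l => sum_nonneg fun _ _ => abs_nonneg _
  have hunit : ∀ c : Fin K → ℝ, c k = 0 → ∑ l, c l ^ 2 = 1 →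
      η * ∑ l, |c l| + ∑ l, c l * ((∑ i, D₀ i l * D₀ i k) * ∑ n, |X l n|)
        ≤ ∑ n, absDeriv (X k n) (∑ l, c l * X l n) := fun c hck hc => by
    obtain ⟨d, hdT, hd⟩ := hT c hck hc
    have h1 := sum_absDeriv_sub_le X k c d hM
    have h2 := mul_le_mul_of_nonneg_right (sum_abs_le_sqrt_mul hδ hd) ((hX0 k).trans (hM k))
    have h3 := sum_mul_gram_mul_le D₀ hck hc hX0 hM
    have h4 := mul_le_mul_of_nonneg_left
      (sum_abs_le_sqrt_mul zero_le_one (hc.trans_le (one_pow 2).ge)) hη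
    linarith [hτ d hdT]
  obtain ⟨r, hr⟩ : ∃ r, r = √(∑ l, c l ^ 2) := ⟨_, rfl⟩
  have hr2 : r ^ 2 = ∑ l, c l ^ 2 := by rw [hr, Real.sq_sqrt (sum_nonneg fun _ _ => sq_nonneg _)]
  rcases (hr ▸ Real.sqrt_nonneg _ : 0 ≤ r).eq_or_lt with h0 | h0
  · rw [← h0, zero_pow two_ne_zero, eq_comm, sum_eq_zero_iff_of_nonneg fun _ _ => sq_nonneg _] at hr2
    have hc0 : ∀ l, c l = 0 := fun l => pow_eq_zero_iff two_ne_zero |>.1 (hr2 l (mem_univ l))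
    have h1 : ∀ z, absDeriv z 0 = 0 := fun z => by
      simpa using absDeriv_mul z 0 le_rfl
    simp [hc0, h1]
  · obtain ⟨u, rfl⟩ : ∃ u : Fin K → ℝ, c = fun l => r * u l :=
      ⟨fun l => c l / r, funext fun l => by field_simp⟩
    have hu := hunit u ((mul_eq_zero.1 hck).resolve_left h0.ne') (by
      simp_rw [mul_pow] at hr2
      rw [← mul_sum] at hr2
      exact mul_left_cancel₀ (pow_pos h0 2).ne' (by rw [← hr2, mul_one]))
    have h1 := mul_le_mul_of_nonneg_left hu h0.le
    simp_rw [abs_mul, abs_of_pos h0, mul_assoc]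
    simp_rw [← mul_sum, absDeriv_mul _ _ h0.le, ← mul_sum]
    linarith

lemma two_point_two_mul_le_sqrt {ε : ℝ} (hε0 : 0 ≤ ε) (hε1 : ε ≤ 1 / 5) : 2.2 * ε ≤ √ε :=
  Real.le_sqrt_of_sq_le (by nlinarith)

lemma sqrt_le_sqrt_mul_sqrt_two_div_pi {p ε a : ℝ} (hp : 0 < p) (hε : 0 ≤ ε) (ha : 0 ≤ a) :
    √ε ≤ √(Real.pi / 2 * (a + ε) * (1 + ε / p)) * √(2 / Real.pi) := by
  have hpi := Real.pi_pos
  rw [← Real.sqrt_mul (by positivity)]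
  refine Real.sqrt_le_sqrt ?_
  have h1 : Real.pi / 2 * (a + ε) * (1 + ε / p) * (2 / Real.pi) = (a + ε) * (1 + ε / p) := by
    field_simp
  rw [h1]
  have h2 : 0 ≤ ε / p := by positivity
  nlinarith

lemma exists_gap {p ε μ a : ℝ} {K N : ℕ} (hK : 0 < K) (hN : 0 < N) (hp0 : 0 < p) (hp : p < 4 / 5)
    (hε0 : 0 < ε) (hε1 : ε < 1 / 5) (ha : 0 ≤ a)
    (hμ : μ ≤ (1 - p) * (1 - 5 * ε) - √(Real.pi / 2 * (a + ε) * (1 + ε / p))) :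
    ∃ η > 0, η * √K + √K * (ε * √(p / K)) * (N * p * ((1 + 2 * ε) * √(2 / Real.pi)))
      + μ * (N * p * ((1 + 2 * ε) * √(2 / Real.pi)))
      ≤ N * p * ((1 - p) * √(2 / Real.pi) - 1.2 * ε) := by
  have hK' : (0 : ℝ) < K := Nat.cast_pos.2 hK
  have hN' : (0 : ℝ) < N := Nat.cast_pos.2 hN
  have hsK : 0 < √(K : ℝ) := Real.sqrt_pos.2 hK'
  have hR := sqrt_le_sqrt_mul_sqrt_two_div_pi hp0 hε0.le ha
  have hε := two_point_two_mul_le_sqrt hε0.le hε1.le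
  have hm0 := sqrt_two_div_pi_gt
  have hm1 := sqrt_two_div_pi_lt
  set m := √(2 / Real.pi)
  set R := √(Real.pi / 2 * (a + ε) * (1 + ε / p))
  have hsp : √p ≤ 0.9 := (Real.sqrt_le_left (by norm_num)).2 (by norm_num; linarith)
  have hδ : √K * (ε * √(p / K)) = ε * √p := by
    rw [Real.sqrt_div hp0.le]; field_simp
  refine ⟨0.28 * ε * (N * p) / √K, by positivity, ?_⟩
  rw [hδ, div_mul_cancel₀ _ hsK.ne']
  have hNp : 0 < N * p := by positivity
  have h1 : √p * m ≤ 0.72 := by nlinarith [Real.sqrt_nonneg p]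
  have h2 : μ * m ≤ (1 - p) * (1 - 5 * ε) * m - 2.2 * ε := by nlinarith
  have h3 : (1 - p) * m * ((1 - 5 * ε) * (1 + 2 * ε)) ≤ (1 - p) * m * 1 :=
    mul_le_mul_of_nonneg_left (by nlinarith) (mul_nonneg (by linarith) (by linarith))
  have h4 : 0.28 * ε + ε * (√p * m) * (1 + 2 * ε) + μ * m * (1 + 2 * ε)
      ≤ (1 - p) * m - 1.2 * ε := by
    nlinarith [mul_le_mul_of_nonneg_left h1 (by positivity : 0 ≤ ε * (1 + 2 * ε)),
      mul_le_mul_of_nonneg_right h2 (by positivity : 0 ≤ 1 + 2 * ε), mul_pos hε0 hε0]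
  linarith [mul_le_mul_of_nonneg_left h4 hNp.le]

lemma net_card_le {p ε : ℝ} {K : ℕ} (hK : 0 < K) (hp0 : 0 < p) (hp : p ≤ 1) (hε0 : 0 < ε)
    (hε1 : ε ≤ 1) : (1 + 2 / (ε * √(p / K))) ^ K + 1
      ≤ 2 * Real.exp ((K : ℝ) / 2 * Real.log (9 * K / (ε ^ 2 * p))) := by
  have hK' : (0 : ℝ) < K := Nat.cast_pos.2 hK
  have hK1 : (1 : ℝ) ≤ K := Nat.one_le_cast.2 hK
  have hδ0 : 0 < ε * √(p / K) := by positivity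
  have hδ1 : ε * √(p / K) ≤ 1 := by
    refine mul_le_one₀ hε1 (Real.sqrt_nonneg _) (Real.sqrt_le_one.2 ?_)
    rw [div_le_one hK']; linarith
  have hδ2 : (ε * √(p / K)) ^ 2 = ε ^ 2 * p / K := by
    rw [mul_pow, Real.sq_sqrt (by positivity)]; ring
  set δ := ε * √(p / K)
  have h1 : 9 * K / (ε ^ 2 * p) = (3 / δ) ^ 2 := by
    rw [div_pow, hδ2]; field_simp; norm_num
  have h2 : Real.exp ((K : ℝ) / 2 * Real.log (9 * K / (ε ^ 2 * p))) = (3 / δ) ^ K := by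
    rw [h1, Real.log_pow, ← Real.exp_log (show 0 < 3 / δ by positivity), ← Real.exp_nat_mul,
      Real.log_exp]
    congr 1
    push_cast
    ring
  have h3 : 1 ≤ 1 / δ := by rwa [one_le_div hδ0]
  have h4 : 3 / δ = 1 / δ + 2 / δ := by ring
  have h5 : 0 ≤ 2 / δ := by positivity
  have h6 : (1 + 2 / δ) ^ K ≤ (3 / δ) ^ K := pow_le_pow_left₀ (by linarith) (by linarith) _
  have h7 : 1 ≤ (3 / δ) ^ K := one_le_pow₀ (by linarith)
  linarith

/-- **Main theorem.** For a Bernoulli–Gaussian random coefficient matrix `X` with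
parameter `p < 4/5`, if `N > πK/(2(1−p)²)` and the basis `D₀` satisfies
`μ₂(D₀) < 1 − p − √(πK/(2N))`, then for every `ε ∈ (0,1/5)` with
`μ₂(D₀) ≤ (1−p)(1−5ε) − √((π/2)(K/N+ε)(1+ε/p))`, the probability that `(D₀, X)` is not
a strict local minimum of (P1') with `Y = D₀·X` is at most
`4K·exp((K/2)·log(9K/(ε²p)) − Np(1−p)ε²(1−2ε)/2)`. -/
theorem stmt3 {K N : ℕ} (hK : 0 < K) (hN : 0 < N) (p : ℝ) (hp0 : 0 < p) (hp : p < 4 / 5)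
    (hNlarge : (N : ℝ) > Real.pi * K / (2 * (1 - p) ^ 2))
    (D₀ : Matrix (Fin K) (Fin K) ℝ) (hunit : UnitCols D₀) (hbasis : IsUnit D₀)
    (hmu : mu2 D₀ < 1 - p - Real.sqrt (Real.pi * K / (2 * N)))
    (ε : ℝ) (hε0 : 0 < ε) (hε1 : ε < 1 / 5)
    (hεmu : mu2 D₀ ≤ (1 - p) * (1 - 5 * ε)
      - Real.sqrt (Real.pi / 2 * ((K : ℝ) / N + ε) * (1 + ε / p))) :
    Measure.pi (fun _ : Fin K × Fin N => bernoulliGaussian p)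
      {ω | ¬ IsStrictLocalMinP1 (D₀ * Matrix.of fun k n => ω (k, n)) D₀
        (Matrix.of fun k n => ω (k, n))}
      ≤ ENNReal.ofReal (4 * K * Real.exp ((K : ℝ) / 2 * Real.log (9 * K / (ε ^ 2 * p))
          - N * p * (1 - p) * ε ^ 2 * (1 - 2 * ε) / 2)) := by
  have hp1 : p ≤ 1 := by linarith
  have hK' : (0 : ℝ) < K := Nat.cast_pos.2 hK
  have := isProbabilityMeasure_bernoulliGaussian hp0.le hp1
  have hδ : 0 < ε * √(p / K) := by positivity
  obtain ⟨η, hη, hgap⟩ := exists_gap hK hN hp0 hp hε0 hε1 (by positivity) hεmu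
  choose T hT hnet hcard using fun k : Fin K => exists_finset_net_unit k hδ
  set P := Measure.pi fun _ : Fin K × Fin N => bernoulliGaussian p
  set τ := N * p * ((1 - p) * √(2 / Real.pi) - 1.2 * ε)
  set M := N * p * ((1 + 2 * ε) * √(2 / Real.pi))
  set A : Fin K → (Fin K → ℝ) → Set (Fin K × Fin N → ℝ) := fun k c =>
    {ω | ∑ n, absDeriv (ω (k, n)) (∑ l, c l * ω (l, n)) ≤ τ}
  set B : Fin K → Set (Fin K × Fin N → ℝ) := fun l => {ω | M ≤ ∑ n, |ω (l, n)|}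
  set E := Real.exp (-(N * p * ε ^ 2 / 2)) with hE
  have hPA : ∀ k, ∀ c ∈ T k, P.real (A k c) ≤ E := fun k c hc => by
    have h := measureReal_sum_absDeriv_le (κ := Fin N) hp0.le hp1 (hT k c hc).1 (hT k c hc).2
      hε0.le hε1.le
    rwa [Fintype.card_fin] at h
  have hPB : ∀ l, P.real (B l) ≤ E := fun l => by
    have h := measureReal_sum_abs_ge (κ := Fin N) hp0.le hp1 l hε0.le hε1.le
    rwa [Fintype.card_fin] at h
  have hsub : {ω : Fin K × Fin N → ℝ | ¬ IsStrictLocalMinP1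
      (D₀ * Matrix.of fun k n => ω (k, n)) D₀ (Matrix.of fun k n => ω (k, n))}
      ⊆ ⋃ k, ((⋃ c ∈ T k, A k c) ∪ B k) := by
    intro ω hω
    by_contra h
    simp only [Set.mem_iUnion, Set.mem_union, not_exists, not_or] at h
    refine hω (isStrictLocalMinP1_of_gap hunit hbasis _ hη fun k c hck => ?_)
    exact gap_of_net D₀ (Matrix.of fun k n => ω (k, n)) (T := T k) hδ.le hη.le (hnet k)
      (fun l => (not_le.1 (h l).2).le) (fun d hd => (not_le.1 ((h k).1 d hd)).le) hgap hck
  have hbound : P.real (⋃ k, ((⋃ c ∈ T k, A k c) ∪ B k))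
      ≤ ∑ _k : Fin K, ((1 + 2 / (ε * √(p / K))) ^ K + 1) * E := by
    refine (measureReal_iUnion_fintype_le _).trans (sum_le_sum fun k _ => ?_)
    refine (measureReal_union_le _ _).trans ?_
    rw [add_mul, one_mul]
    refine add_le_add ((measureReal_biUnion_finset_le _ _).trans ?_) (hPB k)
    refine (sum_le_card_nsmul _ _ _ (hPA k)).trans ?_
    rw [nsmul_eq_mul]
    exact mul_le_mul_of_nonneg_right (hcard k) (Real.exp_pos _).le
  rw [← ofReal_measureReal]
  refine ENNReal.ofReal_le_ofReal (((measureReal_mono hsub).trans hbound).trans ?_)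
  rw [sum_const, card_univ, Fintype.card_fin, nsmul_eq_mul, sub_eq_add_neg, Real.exp_add]
  have hEle : E ≤ Real.exp (-(N * p * (1 - p) * ε ^ 2 * (1 - 2 * ε) / 2)) := by
    rw [hE, Real.exp_le_exp]
    have h1 : (1 - p) * (1 - 2 * ε) ≤ 1 := by nlinarith
    have h2 : 0 ≤ N * p * ε ^ 2 := by positivity
    nlinarith
  have hnc := net_card_le hK hp0 hp1 hε0 (by linarith)
  calc (K : ℝ) * (((1 + 2 / (ε * √(p / K))) ^ K + 1) * E)
      ≤ K * (2 * Real.exp ((K : ℝ) / 2 * Real.log (9 * K / (ε ^ 2 * p)))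
        * Real.exp (-(N * p * (1 - p) * ε ^ 2 * (1 - 2 * ε) / 2))) := by gcongr
    _ ≤ _ := by
      have := mul_pos (mul_pos hK' (Real.exp_pos ((K : ℝ) / 2 * Real.log (9 * K / (ε ^ 2 * p)))))
        (Real.exp_pos (-(N * p * (1 - p) * ε ^ 2 * (1 - 2 * ε) / 2)))
      linarith
end
end

section
/- Let p ∈ (0,1), and let A be a random L×M real matrix with i.i.d. Bernoulli–Gaussian entries of parameter p; denote its columns A_1,…,A_M ∈ ℝ^L. Then for every ε > 0, ℙ( sup_{v ∈ ℝ^L, ‖v‖₂ ≤ 1} Σ_{i=1}^M |⟨A_i, v⟩| > M·√(pL)·(1+ε) ) ≤ 2·exp( − M·p·ε² / (2 + √2·ε) ). -/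
open MeasureTheory Finset
open scoped ENNReal

noncomputable section

/-- Gaussian exponential-square moment, parametrised so that `1 - 2λ = w⁻⁴`. -/
lemma integrable_and_integral_exp_sq_gaussianReal {w : ℝ} (hw : 0 < w) :
    Integrable (fun x : ℝ => Real.exp ((1 - (w ^ 4)⁻¹) / 2 * x ^ 2))
        (ProbabilityTheory.gaussianReal 0 1) ∧
      ∫ x, Real.exp ((1 - (w ^ 4)⁻¹) / 2 * x ^ 2) ∂(ProbabilityTheory.gaussianReal 0 1)
        = w ^ 2 := by
  have hb : 0 < (2 * w ^ 4)⁻¹ := by positivity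
  have hdens : ∀ x : ℝ, ProbabilityTheory.gaussianPDFReal 0 1 x •
      Real.exp ((1 - (w ^ 4)⁻¹) / 2 * x ^ 2)
        = (√(2 * Real.pi))⁻¹ * Real.exp (-(2 * w ^ 4)⁻¹ * x ^ 2) := by
    intro x
    simp only [ProbabilityTheory.gaussianPDFReal, NNReal.coe_one, mul_one, sub_zero, smul_eq_mul]
    rw [mul_assoc, ← Real.exp_add]
    congr 2
    field_simp
    ring
  constructor
  · rw [ProbabilityTheory.gaussianReal_of_var_ne_zero 0 one_ne_zero,
      integrable_withDensity_iff_integrable_smul' (ProbabilityTheory.measurable_gaussianPDF 0 1)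
        (Filter.Eventually.of_forall fun _ => ProbabilityTheory.gaussianPDF_lt_top)]
    simp only [ProbabilityTheory.toReal_gaussianPDF, hdens]
    exact (integrable_exp_neg_mul_sq hb).const_mul _
  · rw [ProbabilityTheory.integral_gaussianReal_eq_integral_smul one_ne_zero]
    simp only [hdens]
    rw [integral_const_mul, integral_gaussian, ← Real.sqrt_inv, ← Real.sqrt_mul (by positivity)]
    rw [Real.sqrt_eq_iff_mul_self_eq (by positivity) (by positivity)]
    field_simp

/-- Moment generating function bound for the square of a Bernoulli–Gaussian variable. -/
lemma integrable_and_integral_exp_sq_bernoulliGaussian {p : ℝ} (hp0 : 0 ≤ p) (hp1 : p ≤ 1)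
    {w : ℝ} (hw : 0 < w) :
    Integrable (fun x : ℝ => Real.exp ((1 - (w ^ 4)⁻¹) / 2 * x ^ 2)) (bernoulliGaussian p) ∧
      ∫ x, Real.exp ((1 - (w ^ 4)⁻¹) / 2 * x ^ 2) ∂(bernoulliGaussian p)
        ≤ Real.exp (p * (w ^ 2 - 1)) := by
  obtain ⟨hint, hval⟩ := integrable_and_integral_exp_sq_gaussianReal hw
  have h1 : Integrable (fun x : ℝ => Real.exp ((1 - (w ^ 4)⁻¹) / 2 * x ^ 2))
      ((1 - p).toNNReal • Measure.dirac (0 : ℝ)) :=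
    (integrable_dirac (by simp)).smul_measure_nnreal
  have h2 := hint.smul_measure_nnreal (c := p.toNNReal)
  refine ⟨h1.add_measure h2, ?_⟩
  rw [bernoulliGaussian, integral_add_measure h1 h2, integral_smul_nnreal_measure,
    integral_smul_nnreal_measure, hval, integral_dirac]
  simp only [NNReal.smul_def, Real.coe_toNNReal _ hp0, Real.coe_toNNReal _ (sub_nonneg.2 hp1),
    smul_eq_mul]
  have := Real.add_one_le_exp (p * (w ^ 2 - 1))
  simp only [ne_eq, OfNat.ofNat_ne_zero, not_false_eq_true, zero_pow, mul_zero, Real.exp_zero]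
  linarith

/-- Chernoff bound for the sum of squares of i.i.d. Bernoulli–Gaussian variables. -/
lemma pi_bernoulliGaussian_sum_sq_ge_le {ι : Type*} [Fintype ι] {p : ℝ} (hp0 : 0 ≤ p)
    (hp1 : p ≤ 1) {w : ℝ} (hw : 1 ≤ w) :
    (Measure.pi fun _ : ι => bernoulliGaussian p).real
        {ω | Fintype.card ι * p * w ^ 6 ≤ ∑ i, ω i ^ 2}
      ≤ Real.exp (-(Fintype.card ι * p * ((w ^ 2 - 1) ^ 2 * (w ^ 2 + 2) / 2))) := by
  have hw0 : 0 < w := by linarith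
  obtain ⟨hint, hval⟩ := integrable_and_integral_exp_sq_bernoulliGaussian hp0 hp1 hw0
  set t : ℝ := (1 - (w ^ 4)⁻¹) / 2 with ht
  have ht0 : 0 ≤ t := by
    have : (w ^ 4)⁻¹ ≤ 1 := inv_le_one_of_one_le₀ (one_le_pow₀ hw)
    linarith
  have hprod : ∀ ω : ι → ℝ, Real.exp (t * ∑ i, ω i ^ 2) = ∏ i, Real.exp (t * ω i ^ 2) := by
    intro ω
    rw [Finset.mul_sum, Real.exp_sum]
  have hI : Integrable (fun ω : ι → ℝ => Real.exp (t * ∑ i, ω i ^ 2))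
      (Measure.pi fun _ : ι => bernoulliGaussian p) := by
    simp only [hprod]
    exact Integrable.fintype_prod fun _ => hint
  refine (ProbabilityTheory.measure_ge_le_exp_mul_mgf _ ht0 hI).trans ?_
  rw [ProbabilityTheory.mgf]
  simp only [hprod]
  rw [integral_fintype_prod_eq_pow fun x : ℝ => Real.exp (t * x ^ 2)]
  calc _ ≤ Real.exp (-t * (Fintype.card ι * p * w ^ 6))
          * Real.exp (p * (w ^ 2 - 1)) ^ Fintype.card ι := by
        gcongr
    _ = _ := by
        rw [← Real.exp_nat_mul, ← Real.exp_add, ht]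
        congr 1
        field_simp
        ring

/-- The optimal Chernoff exponent dominates the Bernstein-type exponent. -/
lemma bernstein_exponent_le {w : ℝ} (hw : 1 ≤ w) :
    (w ^ 3 - 1) ^ 2 / (2 + √2 * (w ^ 3 - 1)) ≤ (w ^ 2 - 1) ^ 2 * (w ^ 2 + 2) / 2 := by
  have hε : 0 ≤ w ^ 3 - 1 := sub_nonneg.2 (one_le_pow₀ hw)
  have hs : 0 ≤ √2 * (w ^ 3 - 1) := by positivity
  have h1 : (w ^ 3 - 1) ^ 2 ≤ (w ^ 2 - 1) ^ 2 * (w ^ 2 + 2) := by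
    have : (w ^ 2 - 1) ^ 2 * (w ^ 2 + 2) - (w ^ 3 - 1) ^ 2 = (w - 1) ^ 2 * (2 * w + 1) := by ring
    have : 0 ≤ (w - 1) ^ 2 * (2 * w + 1) := by positivity
    linarith
  calc _ ≤ (w ^ 3 - 1) ^ 2 / 2 := by gcongr; linarith
    _ ≤ _ := by gcongr

/-- Cauchy–Schwarz: the `ℓ₂ → ℓ₁` norm is at most `√M` times the Frobenius norm. -/
lemma sq_sum_abs_le_card_mul_sum_sq {L M : ℕ} (ω : Fin L × Fin M → ℝ) (v : Fin L → ℝ)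
    (hv : ∑ l, v l ^ 2 ≤ 1) :
    (∑ i, |∑ l, ω (l, i) * v l|) ^ 2 ≤ M * ∑ x, ω x ^ 2 := by
  calc _ ≤ (M : ℝ) * ∑ i, |∑ l, ω (l, i) * v l| ^ 2 := by
        simpa using sq_sum_le_card_mul_sum_sq (s := Finset.univ)
          (f := fun i => |∑ l, ω (l, i) * v l|)
    _ ≤ M * ∑ i, ∑ l, ω (l, i) ^ 2 := by
        gcongr with i
        rw [sq_abs]
        exact (Finset.sum_mul_sq_le_sq_mul_sq _ _ _).trans
          (mul_le_of_le_one_right (by positivity) hv)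
    _ = _ := by rw [Fintype.sum_prod_type_right]

/-- **Lemma (operator norm bound).** If `A` is a random `L×M` matrix with i.i.d.
Bernoulli–Gaussian entries of parameter `p` and columns `A_1,…,A_M`, then for `ε > 0`,
`ℙ(‖Aᵀ‖_{2→1} = sup_{‖v‖₂≤1} Σᵢ |⟨Aᵢ,v⟩| > M√(pL)(1+ε)) ≤ 2·exp(−Mpε²/(2+√2·ε))`. -/
theorem stmt15 (p : ℝ) (hp0 : 0 < p) (hp1 : p < 1) (L M : ℕ) (hL : 0 < L) (hM : 0 < M)
    (ε : ℝ) (hε : 0 < ε) :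
    Measure.pi (fun _ : Fin L × Fin M => bernoulliGaussian p)
      {ω | ∃ v : Fin L → ℝ, Real.sqrt (∑ l, v l ^ 2) ≤ 1 ∧
        (∑ i, |∑ l, ω (l, i) * v l|) > M * Real.sqrt (p * L) * (1 + ε)}
      ≤ ENNReal.ofReal (2 * Real.exp (-(M * p * ε ^ 2) / (2 + Real.sqrt 2 * ε))) := by
  obtain ⟨w, hw, hwε⟩ : ∃ w : ℝ, 1 ≤ w ∧ w ^ 3 = 1 + ε := by
    refine ⟨(1 + ε) ^ ((3 : ℕ) : ℝ)⁻¹, Real.one_le_rpow (by linarith) (by positivity), ?_⟩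
    exact Real.rpow_inv_natCast_pow (by linarith) (by norm_num)
  have hL1 : (1 : ℝ) ≤ L := by exact_mod_cast hL
  have hM0 : (0 : ℝ) < M := by exact_mod_cast hM
  have hsub : {ω : Fin L × Fin M → ℝ | ∃ v : Fin L → ℝ, Real.sqrt (∑ l, v l ^ 2) ≤ 1 ∧
        (∑ i, |∑ l, ω (l, i) * v l|) > M * Real.sqrt (p * L) * (1 + ε)} ⊆
      {ω | Fintype.card (Fin L × Fin M) * p * w ^ 6 ≤ ∑ i, ω i ^ 2} := by
    rintro ω ⟨v, hv, hlt⟩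
    have h1 := sq_sum_abs_le_card_mul_sum_sq ω v (by simpa using hv)
    have h2 : (M * Real.sqrt (p * L) * (1 + ε)) ^ 2 ≤ (∑ i, |∑ l, ω (l, i) * v l|) ^ 2 := by
      gcongr
    have h3 : (M * Real.sqrt (p * L) * (1 + ε)) ^ 2 = M * (L * M * p * w ^ 6) := by
      rw [mul_pow, mul_pow, Real.sq_sqrt (by positivity), ← hwε]
      ring
    rw [h3] at h2
    simpa using le_of_mul_le_mul_left (h2.trans h1) hM0
  refine (measure_mono hsub).trans ?_
  rw [← ofReal_measureReal]
  refine ENNReal.ofReal_le_ofReal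
    ((pi_bernoulliGaussian_sum_sq_ge_le hp0.le hp1.le hw).trans ?_)
  have hb := bernstein_exponent_le hw
  rw [show w ^ 3 - 1 = ε by linarith] at hb
  set r := (w ^ 2 - 1) ^ 2 * (w ^ 2 + 2) / 2
  have hr : 0 ≤ r := by positivity
  have hexp : -(Fintype.card (Fin L × Fin M) * p * r)
      ≤ -(M * p * ε ^ 2) / (2 + Real.sqrt 2 * ε) := by
    simp only [Fintype.card_prod, Fintype.card_fin, Nat.cast_mul]
    rw [neg_div, neg_le_neg_iff, mul_div_assoc]
    calc M * p * (ε ^ 2 / (2 + Real.sqrt 2 * ε)) ≤ 1 * (M * p * r) := by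
          rw [one_mul]
          gcongr
      _ ≤ L * (M * p * r) := by gcongr
      _ = _ := by ring
  have := Real.exp_le_exp.2 hexp
  linarith [Real.exp_pos (-(M * p * ε ^ 2) / (2 + Real.sqrt 2 * ε))]
end
end
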